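/- Let 𝐗, 𝐘, Z be pairwise disjoint node sets in a DAG D with 𝐗 and 𝐘 nonempty. Then Z satisfies the adjustment criterion relative to (𝐗,𝐘) in D if and only if for every linear Gaussian structural equation model compatible with D, every Y ∈ 𝐘 and every assignment x to 𝐗: E[Y | do(𝐗 = x)] = E[Y | 𝐗 = x] when Z = ∅, and E[Y | do(𝐗 = x)] = ∫ E[Y | 𝐗 = x, Z = z] f_Z(z) dz otherwise, where f_Z is the observational marginal density of Z. -/

import Mathlib

attribute [local instance] Classical.propDecidable

/-- A finite directed acyclic graph on vertex type `V`. -/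
structure DAG (V : Type) [Fintype V] [DecidableEq V] where
  /-- the edge relation: `Edge a b` means there is a directed edge `a → b` -/
  Edge : V → V → Prop
  /-- there are no directed cycles -/
  acyclic : ∀ v, ¬ Relation.TransGen Edge v v

namespace DAG

variable {V : Type} [Fintype V] [DecidableEq V]

/-- two nodes are adjacent if they are joined by an edge in either direction -/
def Adj (D : DAG V) (a b : V) : Prop := D.Edge a b ∨ D.Edge b a

/-- `p` is a path from `x` to `y`: a list of distinct nodes, consecutive ones adjacent,
starting at `x` and ending at `y`. -/
def IsPathFrom (D : DAG V) (p : List V) (x y : V) : Prop :=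
  p.Nodup ∧ p.Chain' D.Adj ∧ p.head? = some x ∧ p.getLast? = some y

/-- a causal (directed) path: all edges point forward -/
def IsCausal (D : DAG V) (p : List V) : Prop := p.Chain' D.Edge

/-- descendants of a set of nodes (every node is its own descendant) -/
def Desc (D : DAG V) (S : Set V) : Set V :=
  {v | ∃ w ∈ S, Relation.ReflTransGen D.Edge w v}

/-- ancestors of a set of nodes (every node is its own ancestor) -/
def Anc (D : DAG V) (S : Set V) : Set V :=
  {v | ∃ w ∈ S, Relation.ReflTransGen D.Edge v w}

/-- `w` is a collider on the path `p`: both edges of `p` at `w` point into `w` -/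
def IsColliderOn (D : DAG V) (p : List V) (w : V) : Prop :=
  ∃ a b, [a, w, b] <:+: p ∧ D.Edge a w ∧ D.Edge b w

/-- `w` is a non-collider on `p`: a non-endpoint node of `p` that is not a collider on `p` -/
def IsNonColliderOn (D : DAG V) (p : List V) (w : V) : Prop :=
  (∃ a b, [a, w, b] <:+: p) ∧ ¬ D.IsColliderOn p w

/-- `Z` blocks the path `p`: some non-collider on `p` is in `Z`, or some collider on `p`
has no descendant in `Z`.  Otherwise `p` is d-connecting given `Z`. -/
def Blocks (D : DAG V) (Z : Set V) (p : List V) : Prop :=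
  (∃ w, D.IsNonColliderOn p w ∧ w ∈ Z) ∨
  (∃ w, D.IsColliderOn p w ∧ D.Desc {w} ∩ Z = ∅)

/-- `p` is a proper causal path from `X` to `Y` -/
def ProperCausalPath (D : DAG V) (X Y : Set V) (p : List V) : Prop :=
  (∃ x ∈ X, ∃ y ∈ Y, D.IsPathFrom p x y) ∧ (∀ v ∈ p.tail, v ∉ X) ∧ D.IsCausal p

/-- `p` is a proper non-causal path from `X` to `Y` -/
def ProperNonCausalPath (D : DAG V) (X Y : Set V) (p : List V) : Prop :=
  (∃ x ∈ X, ∃ y ∈ Y, D.IsPathFrom p x y) ∧ (∀ v ∈ p.tail, v ∉ X) ∧ ¬ D.IsCausal p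

/-- the forbidden set: all descendants of nodes `W ∉ X` lying on a proper causal path
from `X` to `Y` -/
def Forb (D : DAG V) (X Y : Set V) : Set V :=
  {v | ∃ p w, D.ProperCausalPath X Y p ∧ w ∈ p ∧ w ∉ X ∧
    Relation.ReflTransGen D.Edge w v}

/-- the adjustment criterion of Shpitser et al. / van der Zander et al. -/
def SatisfiesAC (D : DAG V) (X Y Z : Set V) : Prop :=
  Z ∩ D.Forb X Y = ∅ ∧ ∀ p, D.ProperNonCausalPath X Y p → D.Blocks Z p

/-- the constructive set `Adjust(X,Y,D)` -/
def AdjustSet (D : DAG V) (X Y : Set V) : Set V :=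
  D.Anc (X ∪ Y) \ (X ∪ Y ∪ D.Forb X Y)

/-- `Z` d-separates `X` and `Y` in `D`: `Z` blocks every path from `X` to `Y` -/
def DSep (D : DAG V) (X Y Z : Set V) : Prop :=
  ∀ x ∈ X, ∀ y ∈ Y, ∀ p, D.IsPathFrom p x y → D.Blocks Z p

/-- `p` is a back-door path from `x`: its first edge points into `x` -/
def IsBackdoorFrom (D : DAG V) (p : List V) (x : V) : Prop :=
  ∃ b rest, p = x :: b :: rest ∧ D.Edge b x

/-- Pearl's back-door criterion -/
def BackdoorCriterion (D : DAG V) (X Y Z : Set V) : Prop :=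
  Z ∩ D.Desc X = ∅ ∧
  ∀ x ∈ X, ∀ y ∈ Y, ∀ p, D.IsPathFrom p x y → D.IsBackdoorFrom p x → D.Blocks Z p

/-- the generalized back-door criterion of Maathuis and Colombo -/
def GenBackdoorCriterion (D : DAG V) (X Y Z : Set V) : Prop :=
  Z ∩ D.Desc X = ∅ ∧
  ∀ x ∈ X, ∀ y ∈ Y, ∀ p, D.IsPathFrom p x y → D.IsBackdoorFrom p x →
    D.Blocks ((Z ∪ X) \ {x}) p

end DAG

open MeasureTheory

/-- a linear Gaussian structural equation model compatible with the DAG `D`: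
`V = coef · V + ε`, where `coef j i ≠ 0` only if `i → j` is an edge of `D` and the
errors are independent mean-zero Gaussians with strictly positive variances. -/
structure GaussianSEM (V : Type) [Fintype V] [DecidableEq V] (D : DAG V) where
  /-- the matrix of edge coefficients -/
  coef : Matrix V V ℝ
  /-- the error variances -/
  errVar : V → NNReal
  /-- nonzero coefficients only along edges of `D` -/
  compat : ∀ i j, coef j i ≠ 0 → D.Edge i j
  /-- error variances are strictly positive -/
  errVar_pos : ∀ i, 0 < errVar i

namespace GaussianSEM

variable {V : Type} [Fintype V] [DecidableEq V] {D : DAG V}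

/-- the covariance matrix of the induced (non-degenerate, mean-zero) multivariate
Gaussian observational distribution -/
noncomputable def cov (S : GaussianSEM V D) : Matrix V V ℝ :=
  (1 - S.coef)⁻¹ * Matrix.diagonal (fun i => (S.errVar i : ℝ)) *
    Matrix.transpose (1 - S.coef)⁻¹

/-- `E[Y | do(X = x)]`: the mean of node `y` in the intervened model, in which the
structural equations of the nodes in `X` are replaced by the constant assignment `x` -/
noncomputable def doMean (S : GaussianSEM V D) (X : Set V) (x : V → ℝ) (y : V) : ℝ :=
  Matrix.mulVec (1 - Matrix.of fun i j => if i ∈ X then 0 else S.coef i j)⁻¹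
    (fun i => if i ∈ X then x i else 0) y

/-- `E[Y | W = w]`: the conditional expectation of node `y` given the values `w` on the
node set `W`, in the observational (mean-zero Gaussian) distribution; by the standard
formula for Gaussian conditioning this is `Σ_{yW} (Σ_{WW})⁻¹ w`. -/
noncomputable def condExp (S : GaussianSEM V D) (y : V) (W : Set V) (w : V → ℝ) : ℝ :=
  ∑ i : W,
    S.cov y i.1 *
      Matrix.mulVec ((S.cov.submatrix (fun a : W => a.1) fun a : W => a.1)⁻¹)
        (fun j : W => w j.1) i

/-- the distribution of the error vector `ε` -/
noncomputable def noise (S : GaussianSEM V D) : Measure (V → ℝ) :=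
  Measure.pi fun i => ProbabilityTheory.gaussianReal 0 (S.errVar i)

/-- the observational distribution of `V = (1 - coef)⁻¹ ε` -/
noncomputable def obs (S : GaussianSEM V D) : Measure (V → ℝ) :=
  S.noise.map fun e => Matrix.mulVec (1 - S.coef)⁻¹ e

/-- the observational marginal distribution of the node set `Z` -/
noncomputable def margZ (S : GaussianSEM V D) (Z : Set V) :
    Measure ((i : Z) → ℝ) :=
  S.obs.map fun v (i : Z) => v i.1

/-- `∫ E[Y | X = x, Z = z] f_Z(z) dz`: the integral of the conditional expectation of
`y` given `X = x, Z = z` against the observational marginal distribution of `Z` -/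
noncomputable def adjIntegral (S : GaussianSEM V D) (X Z : Set V) (x : V → ℝ)
    (y : V) : ℝ :=
  ∫ z : (i : Z) → ℝ,
    S.condExp y (X ∪ Z) (fun i => if h : i ∈ Z then z ⟨i, h⟩ else x i) ∂ S.margZ Z

end GaussianSEM

namespace DAG

variable {V : Type} [Fintype V] [DecidableEq V]

theorem wellFounded_edge (D : DAG V) : WellFounded D.Edge := by
  have : Std.Irrefl (Relation.TransGen D.Edge) := ⟨D.acyclic⟩
  exact Subrelation.wf (fun h => Relation.TransGen.single h)
    (Finite.wellFounded_of_trans_of_irrefl (Relation.TransGen D.Edge))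

/-- the matrix `A` of coefficients is supported on the edges of `D` -/
def Compat (D : DAG V) (A : Matrix V V ℝ) : Prop := ∀ i j, A j i ≠ 0 → D.Edge i j

end DAG

namespace Matrix

variable {V : Type} [Fintype V] [DecidableEq V]

/-- the coefficient matrix with all edges out of `W` removed -/
noncomputable def cutOut (A : Matrix V V ℝ) (W : Set V) : Matrix V V ℝ :=
  Matrix.of fun i j => if j ∈ W then 0 else A i j

/-- the total effect `(1 - A)⁻¹` of a coefficient matrix -/
noncomputable def total (A : Matrix V V ℝ) : Matrix V V ℝ := (1 - A)⁻¹

/-- the effect of the nodes of `W` along paths that do not leave a further node of `W` -/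
noncomputable def lastExit (A : Matrix V V ℝ) (W : Set V) : Matrix V V ℝ :=
  (A.cutOut W).total * (A - A.cutOut W)

variable {D : DAG V} {A : Matrix V V ℝ}

omit [Fintype V] [DecidableEq V] in
theorem cutOut_ne_zero {W : Set V} {u v : V} : A.cutOut W v u ≠ 0 ↔ A v u ≠ 0 ∧ u ∉ W := by
  simp [cutOut]; tauto

theorem compat_cutOut (hA : D.Compat A) (W : Set V) : D.Compat (A.cutOut W) :=
  fun i j h => hA i j (cutOut_ne_zero.1 h).1

theorem isUnit_one_sub (hA : D.Compat A) : IsUnit (1 - A) := by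
  rw [← mulVec_injective_iff_isUnit]
  refine (injective_iff_map_eq_zero (Matrix.mulVecLin (1 - A))).2 fun x hx => ?_
  have hx' : x = A *ᵥ x := by
    have : (1 - A) *ᵥ x = 0 := hx
    rw [sub_mulVec, one_mulVec, sub_eq_zero] at this
    exact this
  funext v
  induction v using D.wellFounded_edge.induction with
  | _ v ih =>
    rw [hx']
    refine Finset.sum_eq_zero fun u _ => ?_
    by_cases h : A v u = 0
    · simp [h]
    · simp [ih u (hA u v h)]

theorem total_eq_add_mul (hA : D.Compat A) : A.total = 1 + A * A.total := by
  have h : (1 - A) * A.total = 1 :=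
    mul_nonsing_inv _ ((isUnit_iff_isUnit_det _).1 (isUnit_one_sub hA))
  rw [sub_mul, one_mul, sub_eq_iff_eq_add] at h
  exact h

theorem total_eq_add_mul' (hA : D.Compat A) : A.total = 1 + A.total * A := by
  have h : A.total * (1 - A) = 1 :=
    nonsing_inv_mul _ ((isUnit_iff_isUnit_det _).1 (isUnit_one_sub hA))
  rw [mul_sub, mul_one, sub_eq_iff_eq_add] at h
  exact h

theorem total_apply (hA : D.Compat A) (v u : V) :
    A.total v u = (if v = u then 1 else 0) + ∑ w, A v w * A.total w u := by
  conv_lhs => rw [total_eq_add_mul hA]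
  simp [Matrix.add_apply, Matrix.one_apply, Matrix.mul_apply]

theorem total_apply' (hA : D.Compat A) (v u : V) :
    A.total v u = (if v = u then 1 else 0) + ∑ w, A.total v w * A w u := by
  conv_lhs => rw [total_eq_add_mul' hA]
  simp [Matrix.add_apply, Matrix.one_apply, Matrix.mul_apply]

theorem reflTransGen_of_total_ne_zero (hA : D.Compat A) {v u : V} (h : A.total v u ≠ 0) :
    Relation.ReflTransGen (fun a b => A b a ≠ 0) u v := by
  induction v using D.wellFounded_edge.induction with
  | _ v ih =>
    rw [total_apply hA] at h
    by_cases hvu : v = u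
    · rw [hvu]
    · rw [if_neg hvu, zero_add] at h
      obtain ⟨w, -, hw⟩ := Finset.exists_ne_zero_of_sum_ne_zero h
      have h1 := left_ne_zero_of_mul hw
      exact (ih w (hA w v h1) (right_ne_zero_of_mul hw)).tail h1

theorem total_nonneg (hA : D.Compat A) (h0 : ∀ i j, 0 ≤ A i j) (v u : V) : 0 ≤ A.total v u := by
  induction v using D.wellFounded_edge.induction with
  | _ v ih =>
    rw [total_apply hA]
    refine add_nonneg (by split_ifs <;> simp) (Finset.sum_nonneg fun w _ => ?_)
    by_cases h : A v w = 0
    · simp [h]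
    · exact mul_nonneg (h0 _ _) (ih w (hA w v h))

theorem total_pos (hA : D.Compat A) (h0 : ∀ i j, 0 ≤ A i j) {v u : V}
    (h : Relation.ReflTransGen (fun a b => A b a ≠ 0) u v) : 0 < A.total v u := by
  have hnn := total_nonneg hA h0
  induction h with
  | refl =>
    rw [total_apply hA, if_pos rfl]
    exact add_pos_of_pos_of_nonneg one_pos
      (Finset.sum_nonneg fun w _ => mul_nonneg (h0 _ _) (hnn _ _))
  | @tail b c _ hbc ih =>
    rw [total_apply hA]
    refine add_pos_of_nonneg_of_pos (by split_ifs <;> simp) ?_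
    exact Finset.sum_pos' (fun w _ => mul_nonneg (h0 _ _) (hnn _ _))
      ⟨b, Finset.mem_univ _, mul_pos ((h0 _ _).lt_of_ne' hbc) ih⟩

theorem lastExit_apply (W : Set V) (v w : V) :
    A.lastExit W v w = if w ∈ W then ∑ u, (A.cutOut W).total v u * A u w else 0 := by
  unfold lastExit
  rw [mul_apply]
  split_ifs with h <;> simp [cutOut, h]

theorem lastExit_eq (hA : D.Compat A) (W : Set V) :
    A.lastExit W = 1 - (A.cutOut W).total * (1 - A) := by
  have h : (A.cutOut W).total * (1 - A.cutOut W) = 1 :=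
    nonsing_inv_mul _ ((isUnit_iff_isUnit_det _).1 (isUnit_one_sub (compat_cutOut hA W)))
  calc A.lastExit W = (A.cutOut W).total * (1 - A.cutOut W) - (A.cutOut W).total * (1 - A) := by
        rw [lastExit]; noncomm_ring
    _ = _ := by rw [h]

theorem total_eq_cutOut_add (hA : D.Compat A) (W : Set V) :
    A.total = (A.cutOut W).total + A.lastExit W * A.total := by
  have h : (1 - A) * A.total = 1 :=
    mul_nonsing_inv _ ((isUnit_iff_isUnit_det _).1 (isUnit_one_sub hA))
  rw [lastExit_eq hA, sub_mul, one_mul, Matrix.mul_assoc, h, Matrix.mul_one]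
  abel

theorem total_apply_eq_cutOut_add (hA : D.Compat A) (W : Set V) (v s : V) :
    A.total v s = (A.cutOut W).total v s + ∑ w, A.lastExit W v w * A.total w s := by
  conv_lhs => rw [total_eq_cutOut_add hA W]
  rw [Matrix.add_apply, Matrix.mul_apply]

theorem total_cutOut_eq_zero (hA : D.Compat A) {W : Set V} {v u : V} (hu : u ∈ W) (hv : v ∉ W) :
    (A.cutOut W).total v u = 0 := by
  rw [total_apply' (compat_cutOut hA W), if_neg (show ¬ v = u from fun h => hv (h ▸ hu)), zero_add]
  exact Finset.sum_eq_zero fun w _ => by simp [cutOut, hu]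

/-- a positive definite matrix can be solved on any set of rows by coefficients supported there -/
theorem PosDef.exists_solve {M : Matrix V V ℝ} (hM : M.PosDef) (W : Set V) (r : V → ℝ) :
    ∃ g : V → ℝ, (∀ v, v ∉ W → g v = 0) ∧ ∀ w ∈ W, ∑ j, g j * M j w = r w := by
  set N := M.submatrix (fun a : W => a.1) (fun a : W => a.1) with hN
  have hNu : IsUnit N.det :=
    (isUnit_iff_isUnit_det _).1 (hM.submatrix Subtype.val_injective).isUnit
  set g' : W → ℝ := (fun j : W => r j.1) ᵥ* N⁻¹ with hg'
  have hg : g' ᵥ* N = fun j : W => r j.1 := by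
    rw [hg', vecMul_vecMul, nonsing_inv_mul _ hNu, vecMul_one]
  refine ⟨fun v => if h : v ∈ W then g' ⟨v, h⟩ else 0, fun v hv => by simp [hv], fun w hw => ?_⟩
  have := congrFun hg ⟨w, hw⟩
  rw [← this]
  simp only [vecMul, dotProduct, hN, submatrix_apply]
  rw [← Finset.sum_subset (Finset.subset_univ (Finset.univ.filter (· ∈ W))),
    Finset.sum_subtype (p := (· ∈ W)) _ (by simp)]
  · refine Finset.sum_congr rfl fun x _ => ?_
    rw [dif_pos x.2]
  · intro v _ hv
    rw [dif_neg (by simpa using hv), zero_mul]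

end Matrix

namespace GaussianSEM

variable {V : Type} [Fintype V] [DecidableEq V] {D : DAG V}

/-- the covariance of two linear combinations of independent errors with variances `ω` -/
def errCov (ω : V → ℝ) (f g : V → ℝ) : ℝ := ∑ s, ω s * (f s * g s)

omit [DecidableEq V] in
theorem errCov_comm (ω f g : V → ℝ) : errCov ω f g = errCov ω g f := by
  simp only [errCov, mul_comm (f _)]

omit [DecidableEq V] in
theorem errCov_sub_sum (ω f g : V → ℝ) (c : V → ℝ) (F : V → V → ℝ) :
    errCov ω (fun s => f s - ∑ j, c j * F j s) g
      = errCov ω f g - ∑ j, c j * errCov ω (F j) g := by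
  simp only [errCov, sub_mul, mul_sub, Finset.sum_sub_distrib, Finset.mul_sum, Finset.sum_mul]
  congr 1
  rw [Finset.sum_comm]
  exact Finset.sum_congr rfl fun j _ => Finset.sum_congr rfl fun s _ => by ring

omit [DecidableEq V] in
theorem errCov_add_sum_right (ω f g : V → ℝ) (c : V → ℝ) (F : V → V → ℝ) :
    errCov ω f (fun s => g s + ∑ j, c j * F j s)
      = errCov ω f g + ∑ j, c j * errCov ω f (F j) := by
  simp only [errCov, mul_add, Finset.sum_add_distrib, Finset.mul_sum]
  congr 1
  rw [Finset.sum_comm]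
  exact Finset.sum_congr rfl fun j _ => Finset.sum_congr rfl fun s _ => by ring

/-- the error variances as real numbers -/
noncomputable def var (S : GaussianSEM V D) : V → ℝ := fun s => S.errVar s

theorem var_pos (S : GaussianSEM V D) (s : V) : 0 < S.var s := by
  exact_mod_cast S.errVar_pos s

theorem mul_diagonal_mul_transpose_apply (B : Matrix V V ℝ) (ω : V → ℝ) (a b : V) :
    (B * Matrix.diagonal ω * B.transpose) a b = errCov ω (B a) (B b) := by
  rw [Matrix.mul_apply]
  exact Finset.sum_congr rfl fun s _ => by
    rw [Matrix.mul_diagonal, Matrix.transpose_apply]; ring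

theorem cov_apply (S : GaussianSEM V D) (a b : V) :
    S.cov a b = errCov S.var (S.coef.total a) (S.coef.total b) :=
  mul_diagonal_mul_transpose_apply S.coef.total S.var a b

theorem posDef_total {A : Matrix V V ℝ} (hA : D.Compat A) {ω : V → ℝ} (hω : ∀ s, 0 < ω s) :
    (A.total * Matrix.diagonal ω * A.total.transpose).PosDef := by
  rw [← Matrix.conjTranspose_eq_transpose_of_trivial]
  refine (Matrix.PosDef.diagonal hω).mul_mul_conjTranspose_same ?_
  rw [Matrix.vecMul_injective_iff_isUnit, Matrix.total, Matrix.isUnit_nonsing_inv_iff]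
  exact Matrix.isUnit_one_sub hA

/-- regression on `W` in the model with coefficients `A`, of an arbitrary combination of errors -/
theorem exists_projection {A : Matrix V V ℝ} (hA : D.Compat A) {ω : V → ℝ} (hω : ∀ s, 0 < ω s)
    (W : Set V) (f : V → ℝ) :
    ∃ g : V → ℝ, (∀ v, v ∉ W → g v = 0) ∧
      ∀ w ∈ W, ∑ j, g j * errCov ω (A.total j) (A.total w) = errCov ω f (A.total w) := by
  obtain ⟨g, hg, h⟩ := (posDef_total hA hω).exists_solve W fun w => errCov ω f (A.total w)
  refine ⟨g, hg, fun w hw => ?_⟩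
  rw [← h w hw]
  simp only [mul_diagonal_mul_transpose_apply]

/-- `c` are coefficients, supported on `W`, of the population regression of `y` on `W` -/
structure IsRegression (S : GaussianSEM V D) (y : V) (W : Set V) (c : V → ℝ) : Prop where
  eq_zero : ∀ v, v ∉ W → c v = 0
  normal : ∀ w ∈ W, ∑ j, c j * S.cov j w = S.cov y w

theorem exists_isRegression (S : GaussianSEM V D) (y : V) (W : Set V) :
    ∃ c, S.IsRegression y W c := by
  obtain ⟨c, h0, h⟩ := exists_projection S.compat S.var_pos W (S.coef.total y)
  exact ⟨c, h0, by simpa only [cov_apply] using h⟩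

theorem IsRegression.condExp_eq {S : GaussianSEM V D} {y : V} {W : Set V} {c : V → ℝ}
    (h : S.IsRegression y W c) (w : V → ℝ) : S.condExp y W w = ∑ j, c j * w j := by
  set N := S.cov.submatrix (fun a : W => a.1) (fun a : W => a.1) with hN
  have hNu : IsUnit N.det := (Matrix.isUnit_iff_isUnit_det _).1
    ((posDef_total S.compat S.var_pos).submatrix Subtype.val_injective).isUnit
  have hsub : ∀ f : V → ℝ, ∑ j, c j * f j = ∑ j : W, c j.1 * f j.1 := fun f => by
    rw [← Finset.sum_subset (Finset.subset_univ (Finset.univ.filter (· ∈ W))),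
      Finset.sum_subtype (p := (· ∈ W)) _ (by simp)]
    intro v _ hv
    rw [h.eq_zero v (by simpa using hv), zero_mul]
  have hrow : (fun i : W => S.cov y i.1) = Matrix.vecMul (fun j : W => c j.1) N := by
    funext i
    rw [← h.normal i.1 i.2, hsub]
    rfl
  calc S.condExp y W w
      = (fun i : W => S.cov y i.1) ⬝ᵥ Matrix.mulVec N⁻¹ (fun j : W => w j.1) := rfl
    _ = (fun j : W => c j.1) ⬝ᵥ (fun j : W => w j.1) := by
        rw [hrow, Matrix.dotProduct_mulVec, Matrix.vecMul_vecMul, Matrix.mul_nonsing_inv _ hNu,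
          Matrix.vecMul_one]
    _ = ∑ j, c j * w j := (hsub w).symm

theorem integral_noise_linear (S : GaussianSEM V D) (a : ℝ) (d : V → ℝ) :
    ∫ e, (a + ∑ s, d s * e s) ∂S.noise = a := by
  unfold noise
  have hint : ∀ s : V, Integrable (fun e : V → ℝ => d s * e s)
      (Measure.pi fun i => ProbabilityTheory.gaussianReal 0 (S.errVar i)) := fun s =>
    Integrable.const_mul (f := fun e : V → ℝ => e s)
      (integrable_eval (μ := fun i => ProbabilityTheory.gaussianReal 0 (S.errVar i))
        ((ProbabilityTheory.memLp_id_gaussianReal 1).integrable le_rfl)) _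
  rw [integral_add (integrable_const _) (integrable_finsetSum _ fun s _ => hint s),
    integral_finsetSum _ fun s _ => hint s, Finset.sum_eq_zero, add_zero, integral_const]
  · simp
  · intro s _
    rw [integral_const_mul, integral_comp_eval
      (μ := fun i => ProbabilityTheory.gaussianReal 0 (S.errVar i)) (i := s) (f := fun t : ℝ => t)
      (by fun_prop), ProbabilityTheory.integral_id_gaussianReal, mul_zero]

theorem IsRegression.adjIntegral_eq {S : GaussianSEM V D} {y : V} {X Z : Set V} {c : V → ℝ}
    (h : S.IsRegression y (X ∪ Z) c) (hXZ : Disjoint X Z) (x : V → ℝ) :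
    S.adjIntegral X Z x y = ∑ j, if j ∈ X then c j * x j else 0 := by
  unfold adjIntegral margZ obs
  simp only [h.condExp_eq]
  have hm1 : Measurable fun e : V → ℝ => Matrix.mulVec (1 - S.coef)⁻¹ e := by
    unfold Matrix.mulVec dotProduct; fun_prop
  have hm2 : Measurable fun (v : V → ℝ) (i : Z) => v i.1 := by fun_prop
  have hm3 : Continuous fun z : (i : Z) → ℝ =>
      ∑ j, c j * (if h : j ∈ Z then z ⟨j, h⟩ else x j) := by
    refine continuous_finsetSum _ fun j _ => continuous_const.mul ?_
    by_cases hj : j ∈ Z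
    · simp only [hj, dif_pos]; fun_prop
    · simp only [hj, dif_neg, not_false_eq_true]; fun_prop
  rw [Measure.map_map hm2 hm1, integral_map (hm2.comp hm1).aemeasurable hm3.aestronglyMeasurable,
    ← S.integral_noise_linear (∑ j, if j ∈ X then c j * x j else 0)
      (fun s => ∑ j, if j ∈ Z then c j * S.coef.total j s else 0)]
  refine integral_congr_ae (Filter.Eventually.of_forall fun e => ?_)
  simp only [Finset.sum_mul]
  rw [Finset.sum_comm, ← Finset.sum_add_distrib]
  refine Finset.sum_congr rfl fun j _ => ?_
  by_cases hj : j ∈ Z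
  · rw [dif_pos hj, if_neg (hXZ.notMem_of_mem_right hj), zero_add]
    simp only [hj, if_true, mul_assoc]
    rw [← Finset.mul_sum]
    rfl
  · rw [dif_neg hj]
    simp only [hj, if_false, zero_mul, Finset.sum_const_zero, add_zero]
    split_ifs with hx
    · rfl
    · rw [h.eq_zero j (by simp [hx, hj]), zero_mul]

/-- adjusting for `Z` gives the mean of `y` under the intervention setting `X` to `x` -/
def Adjusts (S : GaussianSEM V D) (X Z : Set V) (x : V → ℝ) (y : V) : Prop :=
  (Z = ∅ → S.doMean X x y = S.condExp y X x) ∧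
    (Z ≠ ∅ → S.doMean X x y = S.adjIntegral X Z x y)

theorem IsRegression.adjusts_iff {S : GaussianSEM V D} {y : V} {X Z : Set V} {c : V → ℝ}
    (h : S.IsRegression y (X ∪ Z) c) (hXZ : Disjoint X Z) (x : V → ℝ) :
    S.Adjusts X Z x y ↔ S.doMean X x y = ∑ j, if j ∈ X then c j * x j else 0 := by
  unfold Adjusts
  by_cases hZ : Z = ∅
  · subst hZ
    rw [Set.union_empty] at h
    have : ∑ j, c j * x j = ∑ j, if j ∈ X then c j * x j else 0 :=
      Finset.sum_congr rfl fun j _ => by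
        split_ifs with hj
        · rfl
        · rw [h.eq_zero j hj, zero_mul]
    simp [h.condExp_eq, this]
  · simp [hZ, h.adjIntegral_eq hXZ]

end GaussianSEM

namespace DAG

variable {V : Type} [Fintype V] [DecidableEq V]

/-- edges of `D` that do not leave `W` -/
def EdgeOff (D : DAG V) (W : Set V) (a b : V) : Prop := D.Edge a b ∧ a ∉ W

/-- `a` and `b` have a common ancestor along directed paths with no node of `Z` before their end -/
def Trek (D : DAG V) (Z : Set V) (a b : V) : Prop :=
  ∃ s, Relation.ReflTransGen (D.EdgeOff Z) s a ∧ Relation.ReflTransGen (D.EdgeOff Z) s b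

/-- as `Trek` from `a` to `y`, but the directed path to `y` also avoids `X` -/
def TrekTo (D : DAG V) (X Z : Set V) (y a : V) : Prop :=
  ∃ s, Relation.ReflTransGen (D.EdgeOff Z) s a ∧ Relation.ReflTransGen (D.EdgeOff (X ∪ Z)) s y

/-- `a` is joined to `y` by a sequence of treks whose intermediate ends lie in `Z` -/
inductive Linked (D : DAG V) (X Z : Set V) (y : V) : V → Prop
  | base {a : V} : D.TrekTo X Z y a → Linked D X Z y a
  | step {z a : V} : Linked D X Z y z → z ∈ Z → D.Trek Z z a → Linked D X Z y a

/-- some node of `Z` is a descendant of `X` and a parent of a node with a directed path to `y`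
that avoids `X ∪ Z` -/
def Mediated (D : DAG V) (X Z : Set V) (y : V) : Prop :=
  ∃ z ∈ Z, z ∈ D.Desc X ∧ ∃ v, D.Edge z v ∧ Relation.ReflTransGen (D.EdgeOff (X ∪ Z)) v y

theorem Trek.symm {D : DAG V} {Z : Set V} {a b : V} (h : D.Trek Z a b) : D.Trek Z b a := by
  obtain ⟨s, h1, h2⟩ := h
  exact ⟨s, h2, h1⟩

theorem reflTransGen_edgeOff_of_total_cutOut_ne_zero {D : DAG V} {A : Matrix V V ℝ}
    (hA : D.Compat A) {W : Set V} {v u : V} (h : (A.cutOut W).total v u ≠ 0) :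
    Relation.ReflTransGen (D.EdgeOff W) u v :=
  Relation.ReflTransGen.mono
    (fun a b hab => ⟨hA a b (Matrix.cutOut_ne_zero.1 hab).1, (Matrix.cutOut_ne_zero.1 hab).2⟩) _ _
    (Matrix.reflTransGen_of_total_ne_zero (Matrix.compat_cutOut hA W) h)

theorem EdgeOff.reflTransGen {D : DAG V} {W : Set V} {a b : V}
    (h : Relation.ReflTransGen (D.EdgeOff W) a b) : Relation.ReflTransGen D.Edge a b :=
  Relation.ReflTransGen.mono (fun _ _ hab => hab.1) _ _ h

end DAG

namespace GaussianSEM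

variable {V : Type} [Fintype V] [DecidableEq V] {D : DAG V}

omit [DecidableEq V] in
theorem exists_ne_zero_of_errCov_ne_zero {ω f g : V → ℝ} (h : errCov ω f g ≠ 0) :
    ∃ s, f s ≠ 0 ∧ g s ≠ 0 := by
  obtain ⟨s, -, hs⟩ := Finset.exists_ne_zero_of_sum_ne_zero h
  have := right_ne_zero_of_mul hs
  exact ⟨s, left_ne_zero_of_mul this, right_ne_zero_of_mul this⟩

theorem errCov_total (S : GaussianSEM V D) (W : Set V) (f : V → ℝ) (w : V) :
    errCov S.var f (S.coef.total w) = errCov S.var f ((S.coef.cutOut W).total w)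
      + ∑ j, S.coef.lastExit W w j * errCov S.var f (S.coef.total j) := by
  rw [← errCov_add_sum_right S.var f ((S.coef.cutOut W).total w) (S.coef.lastExit W w)
    S.coef.total]
  congr 1
  funext s
  exact Matrix.total_apply_eq_cutOut_add S.compat W w s

/-- orthogonality to `X ∪ Z` may be tested in the model where the edges out of `Z` are removed -/
theorem errCov_total_eq_zero (S : GaussianSEM V D) {X Z : Set V} {f : V → ℝ}
    (h : ∀ w ∈ X ∪ Z, errCov S.var f ((S.coef.cutOut Z).total w) = 0) :
    ∀ w ∈ X ∪ Z, errCov S.var f (S.coef.total w) = 0 := by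
  have : Std.Irrefl (Relation.TransGen D.Edge) := ⟨D.acyclic⟩
  have hwf := Finite.wellFounded_of_trans_of_irrefl (Relation.TransGen D.Edge)
  intro w
  induction w using hwf.induction with
  | _ w ih =>
    intro hw
    rw [S.errCov_total Z, h w hw, zero_add]
    refine Finset.sum_eq_zero fun j _ => ?_
    by_cases hj : S.coef.lastExit Z w j = 0
    · simp [hj]
    rw [Matrix.lastExit_apply] at hj
    split_ifs at hj with hjZ
    · obtain ⟨u, -, hu⟩ := Finset.exists_ne_zero_of_sum_ne_zero hj
      have h1 := S.compat _ _ (right_ne_zero_of_mul hu)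
      have h2 := DAG.reflTransGen_edgeOff_of_total_cutOut_ne_zero S.compat
        (left_ne_zero_of_mul hu)
      rw [ih j (Relation.TransGen.head' h1 (DAG.EdgeOff.reflTransGen h2)) (Or.inr hjZ), mul_zero]
    · exact absurd rfl hj

theorem exists_isRegression_of_not_linked (S : GaussianSEM V D) {X Z : Set V} {y : V}
    (hXZ : Disjoint X Z) (hl : ∀ x ∈ X, ¬ D.Linked X Z y x) :
    ∃ c, S.IsRegression y (X ∪ Z) c ∧ ∀ x ∈ X, c x = S.coef.lastExit (X ∪ Z) y x := by
  obtain ⟨g, hg0, hg⟩ := exists_projection (Matrix.compat_cutOut S.compat Z) S.var_pos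
    {z | z ∈ Z ∧ D.Linked X Z y z} ((S.coef.cutOut (X ∪ Z)).total y)
  have hgX : ∀ j, j ∉ Z → g j - ∑ z, g z * S.coef.lastExit Z z j = 0 := fun j hj => by
    simp [hg0 j (fun h => hj h.1), Matrix.lastExit_apply, hj]
  refine ⟨fun j => S.coef.lastExit (X ∪ Z) y j + (g j - ∑ z, g z * S.coef.lastExit Z z j),
    ⟨fun v hv => ?_, ?_⟩, fun x hx => ?_⟩
  · rw [hgX v (fun h => hv (Or.inr h)), Matrix.lastExit_apply, if_neg hv, add_zero]
  · set f : V → ℝ := fun s => (S.coef.cutOut (X ∪ Z)).total y s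
      - ∑ z, g z * (S.coef.cutOut Z).total z s with hf
    have horth : ∀ w ∈ X ∪ Z, errCov S.var f (S.coef.total w) = 0 := by
      refine S.errCov_total_eq_zero fun w hw => ?_
      rw [hf, errCov_sub_sum S.var ((S.coef.cutOut (X ∪ Z)).total y) ((S.coef.cutOut Z).total w) g
        (S.coef.cutOut Z).total]
      by_cases hwl : D.Linked X Z y w
      · have hwZ : w ∈ Z := hw.resolve_left fun h => hl w h hwl
        rw [← hg w ⟨hwZ, hwl⟩, sub_self]
      · have h1 : errCov S.var ((S.coef.cutOut (X ∪ Z)).total y)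
            ((S.coef.cutOut Z).total w) = 0 := by
          by_contra hne
          obtain ⟨s, hs1, hs2⟩ := exists_ne_zero_of_errCov_ne_zero hne
          exact hwl (.base ⟨s, DAG.reflTransGen_edgeOff_of_total_cutOut_ne_zero S.compat hs2,
            DAG.reflTransGen_edgeOff_of_total_cutOut_ne_zero S.compat hs1⟩)
        rw [h1, zero_sub, neg_eq_zero]
        refine Finset.sum_eq_zero fun z _ => ?_
        by_contra hne
        have hz : z ∈ Z ∧ D.Linked X Z y z := by
          by_contra h
          exact hne (by rw [hg0 z h, zero_mul])
        obtain ⟨s, hs1, hs2⟩ := exists_ne_zero_of_errCov_ne_zero (right_ne_zero_of_mul hne)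
        exact hwl (.step hz.2 hz.1
          ⟨s, DAG.reflTransGen_edgeOff_of_total_cutOut_ne_zero S.compat hs1,
            DAG.reflTransGen_edgeOff_of_total_cutOut_ne_zero S.compat hs2⟩)
    intro w hw
    simp only [cov_apply]
    rw [eq_comm, ← sub_eq_zero, ← errCov_sub_sum S.var (S.coef.total y) (S.coef.total w) _
      S.coef.total, ← horth w hw]
    congr 1
    funext s
    rw [Matrix.total_apply_eq_cutOut_add S.compat (X ∪ Z) y s, hf]
    have hz : ∀ z, (S.coef.cutOut Z).total z s
        = S.coef.total z s - ∑ j, S.coef.lastExit Z z j * S.coef.total j s := fun z => by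
      rw [Matrix.total_apply_eq_cutOut_add S.compat Z z s]; ring
    simp only [hz, add_mul, sub_mul, mul_sub, Finset.sum_add_distrib, Finset.sum_sub_distrib,
      Finset.mul_sum, Finset.sum_mul]
    rw [Finset.sum_comm (f := fun z j => g z * (S.coef.lastExit Z z j * S.coef.total j s))]
    simp only [mul_assoc]
    ring
  · beta_reduce
    rw [hgX x (hXZ.notMem_of_mem_left hx), add_zero]

section DoMean

variable (S : GaussianSEM V D) (X Z : Set V) (x : V → ℝ)

theorem doMean_eq (v : V) :
    S.doMean X x v = if v ∈ X then x v else ∑ u, S.coef v u * S.doMean X x u := by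
  set A : Matrix V V ℝ := Matrix.of fun i j => if i ∈ X then 0 else S.coef i j with hAdef
  have hA : D.Compat A := fun i j h => S.compat i j (by
    simp only [hAdef, Matrix.of_apply] at h; split_ifs at h <;> simp_all)
  have hm : ∀ u, S.doMean X x u = (A.total.mulVec fun i => if i ∈ X then x i else 0) u :=
    fun u => rfl
  have := Matrix.total_eq_add_mul hA
  rw [hm, this, Matrix.add_mulVec, Matrix.one_mulVec, ← Matrix.mulVec_mulVec, Pi.add_apply]
  simp only [hm]
  split_ifs with hv
  · simp [Matrix.mulVec, dotProduct, hAdef, hv]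
  · simp only [zero_add]
    exact Finset.sum_congr rfl fun u _ => by simp [hAdef, hv]

theorem doMean_eq_sum_lastExit {y : V} (hy : y ∉ X ∪ Z) :
    S.doMean X x y = ∑ u, S.coef.lastExit (X ∪ Z) y u * S.doMean X x u := by
  have h0 : ((S.coef.cutOut (X ∪ Z)).total * (1 - S.coef)).mulVec (S.doMean X x) y = 0 := by
    rw [← Matrix.mulVec_mulVec]
    refine Finset.sum_eq_zero fun v _ => ?_
    by_cases hv : v ∈ X
    · simp only
      rw [Matrix.total_cutOut_eq_zero S.compat (Or.inl hv) hy, zero_mul]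
    · rw [Matrix.sub_mulVec, Matrix.one_mulVec, Pi.sub_apply, S.doMean_eq X x v, if_neg hv]
      simp [Matrix.mulVec, dotProduct]
  have h1 : (S.coef.lastExit (X ∪ Z)).mulVec (S.doMean X x) y = S.doMean X x y := by
    rw [Matrix.lastExit_eq S.compat, Matrix.sub_mulVec, Matrix.one_mulVec, Pi.sub_apply, h0,
      sub_zero]
  exact h1.symm

theorem mem_desc_of_doMean_ne_zero {v : V} (h : S.doMean X x v ≠ 0) : v ∈ D.Desc X := by
  induction v using D.wellFounded_edge.induction with
  | _ v ih =>
    rw [doMean_eq] at h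
    split_ifs at h with hv
    · exact ⟨v, hv, .refl⟩
    · obtain ⟨u, -, hu⟩ := Finset.exists_ne_zero_of_sum_ne_zero h
      have huv := S.compat _ _ (left_ne_zero_of_mul hu)
      obtain ⟨w, hw, hwu⟩ := ih u huv (right_ne_zero_of_mul hu)
      exact ⟨w, hw, hwu.tail huv⟩

end DoMean

theorem exists_of_lastExit_ne_zero (S : GaussianSEM V D) {W : Set V} {y w : V}
    (h : S.coef.lastExit W y w ≠ 0) :
    w ∈ W ∧ ∃ v, D.Edge w v ∧ Relation.ReflTransGen (D.EdgeOff W) v y := by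
  rw [Matrix.lastExit_apply] at h
  split_ifs at h with hw
  · obtain ⟨v, -, hv⟩ := Finset.exists_ne_zero_of_sum_ne_zero h
    exact ⟨hw, v, S.compat _ _ (right_ne_zero_of_mul hv),
      DAG.reflTransGen_edgeOff_of_total_cutOut_ne_zero S.compat (left_ne_zero_of_mul hv)⟩
  · exact absurd rfl h

/-- adjustment is valid when no node of `X` is linked to `y` and `Z` is no mediator -/
theorem adjusts_of_not_linked (S : GaussianSEM V D) {X Z : Set V} {y : V}
    (hXZ : Disjoint X Z) (hy : y ∉ X ∪ Z) (hl : ∀ x ∈ X, ¬ D.Linked X Z y x)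
    (hm : ¬ D.Mediated X Z y) (x : V → ℝ) : S.Adjusts X Z x y := by
  obtain ⟨c, hc, hcX⟩ := S.exists_isRegression_of_not_linked hXZ hl
  rw [hc.adjusts_iff hXZ, S.doMean_eq_sum_lastExit X Z x hy]
  refine Finset.sum_congr rfl fun u _ => ?_
  split_ifs with hu
  · rw [hcX u hu, S.doMean_eq X x u, if_pos hu]
  · by_contra hne
    obtain ⟨huW, v, huv, hvy⟩ := S.exists_of_lastExit_ne_zero (left_ne_zero_of_mul hne)
    exact hm ⟨u, huW.resolve_left hu,
      S.mem_desc_of_doMean_ne_zero X x (right_ne_zero_of_mul hne), v, huv, hvy⟩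

end GaussianSEM

namespace DAG

variable {V : Type} [Fintype V] [DecidableEq V] {D : DAG V}

/-- a sequence of `k` treks from `t 0` through nodes of `Z`, followed by one to `y` -/
structure LinkChain (D : DAG V) (X Z : Set V) (y : V) (k : ℕ) (t : ℕ → V) : Prop where
  mem : ∀ i < k, t (i + 1) ∈ Z
  trek : ∀ i < k, D.Trek Z (t i) (t (i + 1))
  last : D.TrekTo X Z y (t k)

theorem Linked.exists_linkChain {X Z : Set V} {y a : V} (h : D.Linked X Z y a) :
    ∃ k t, t 0 = a ∧ D.LinkChain X Z y k t := by
  induction h with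
  | @base a h => exact ⟨0, fun _ => a, rfl, by simp, by simp, h⟩
  | @step z a _ hz ht ih =>
    obtain ⟨k, t, rfl, h⟩ := ih
    refine ⟨k + 1, fun i => Nat.casesOn i a t, rfl, ⟨fun i hi => ?_, fun i hi => ?_, h.last⟩⟩
    · cases i with
      | zero => exact hz
      | succ i => exact h.mem i (by omega)
    · cases i with
      | zero => exact ht.symm
      | succ i => exact h.trek i (by omega)

theorem LinkChain.shortcut {X Z : Set V} {y : V} {k : ℕ} {t : ℕ → V} (h : D.LinkChain X Z y k t)
    {i j : ℕ} (hij : i + 2 ≤ j) (hj : j ≤ k) (ht : D.Trek Z (t i) (t j)) :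
    D.LinkChain X Z y (k - (j - i - 1)) fun m => if m ≤ i then t m else t (m + (j - i - 1)) := by
  refine ⟨fun m hm => ?_, fun m hm => ?_, ?_⟩
  · split_ifs with h1
    · exact h.mem m (by omega)
    · rw [show m + 1 + (j - i - 1) = m + (j - i - 1) + 1 by omega]
      exact h.mem _ (by omega)
  · rcases lt_trichotomy m i with hmi | rfl | hmi
    · simpa [hmi.le, Nat.succ_le_of_lt hmi] using h.trek m (by omega)
    · simpa [show m + 1 + (j - m - 1) = j by omega] using ht
    · have := h.trek (m + (j - i - 1)) (by omega)
      rw [show m + (j - i - 1) + 1 = m + 1 + (j - i - 1) by omega] at this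
      simpa [hmi.not_ge, show ¬ m + 1 ≤ i by omega] using this
  · simpa [show ¬ k - (j - i - 1) ≤ i by omega, show k - (j - i - 1) + (j - i - 1) = k by omega]
      using h.last

theorem exists_shortest_linkChain {X Z : Set V} {y x : V} (hx : x ∈ X) (h : D.Linked X Z y x) :
    ∃ k t, t 0 ∈ X ∧ D.LinkChain X Z y k t ∧ (∀ i < k, ¬ D.TrekTo X Z y (t i)) ∧
      ∀ i j, i + 2 ≤ j → j ≤ k → ¬ D.Trek Z (t i) (t j) := by
  have hex : ∃ k t, t 0 ∈ X ∧ D.LinkChain X Z y k t := by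
    obtain ⟨k, t, rfl, ht⟩ := h.exists_linkChain
    exact ⟨k, t, hx, ht⟩
  obtain ⟨t, h0, ht⟩ := Nat.find_spec hex
  refine ⟨Nat.find hex, t, h0, ht, fun i hi hl => Nat.find_min hex hi
    ⟨t, h0, fun m hm => ht.mem m (hm.trans hi), fun m hm => ht.trek m (hm.trans hi), hl⟩,
    fun i j hij hj htr => Nat.find_min hex (m := Nat.find hex - (j - i - 1)) (by omega)
      ⟨_, by simpa using h0, ht.shortcut hij hj htr⟩⟩

end DAG

namespace GaussianSEM

variable {V : Type} [Fintype V] [DecidableEq V] {D : DAG V}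

/-- the model with coefficient `1` on the edges in `F`, all others being `0`, and unit variances -/
noncomputable def ofRel (F : V → V → Prop) (hF : ∀ a b, F a b → D.Edge a b) : GaussianSEM V D where
  coef := Matrix.of fun v u => if F u v then 1 else 0
  errVar _ := 1
  compat i j h := hF i j (by by_contra hn; simp [hn] at h)
  errVar_pos _ := one_pos

section OfRel

variable {F : V → V → Prop} {hF : ∀ a b, F a b → D.Edge a b}

theorem ofRel_coef (u v : V) : (ofRel F hF).coef v u = if F u v then 1 else 0 := rfl

theorem ofRel_coef_nonneg (v u : V) : 0 ≤ (ofRel F hF).coef v u := by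
  rw [ofRel_coef]; split_ifs <;> simp

theorem ofRel_coef_ne_zero {u v : V} : (ofRel F hF).coef v u ≠ 0 ↔ F u v := by
  simp [ofRel_coef]

theorem ofRel_cutOut_nonneg (W : Set V) (v u : V) : 0 ≤ (ofRel F hF).coef.cutOut W v u := by
  simp only [Matrix.cutOut, Matrix.of_apply]
  split_ifs
  · rfl
  · exact ofRel_coef_nonneg v u

theorem ofRel_cutOut_ne_zero {W : Set V} {u v : V} :
    (ofRel F hF).coef.cutOut W v u ≠ 0 ↔ F u v ∧ u ∉ W := by
  rw [Matrix.cutOut_ne_zero, ofRel_coef_ne_zero]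

theorem ofRel_total_nonneg (v u : V) : 0 ≤ (ofRel F hF).coef.total v u :=
  Matrix.total_nonneg (ofRel F hF).compat ofRel_coef_nonneg v u

theorem ofRel_total_pos {u v : V} (h : Relation.ReflTransGen F u v) :
    0 < (ofRel F hF).coef.total v u :=
  Matrix.total_pos (ofRel F hF).compat ofRel_coef_nonneg
    (Relation.ReflTransGen.mono (fun _ _ hab => ofRel_coef_ne_zero.2 hab) _ _ h)

theorem reflTransGen_of_ofRel_total_ne_zero {u v : V} (h : (ofRel F hF).coef.total v u ≠ 0) :
    Relation.ReflTransGen F u v :=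
  Relation.ReflTransGen.mono (fun _ _ hab => ofRel_coef_ne_zero.1 hab) _ _
    (Matrix.reflTransGen_of_total_ne_zero (ofRel F hF).compat h)

theorem ofRel_cutOut_total_nonneg (W : Set V) (v u : V) :
    0 ≤ ((ofRel F hF).coef.cutOut W).total v u :=
  Matrix.total_nonneg (Matrix.compat_cutOut (ofRel F hF).compat W) (ofRel_cutOut_nonneg W) v u

theorem ofRel_cutOut_total_pos {W : Set V} {u v : V}
    (h : Relation.ReflTransGen (fun a b => F a b ∧ a ∉ W) u v) :
    0 < ((ofRel F hF).coef.cutOut W).total v u :=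
  Matrix.total_pos (Matrix.compat_cutOut (ofRel F hF).compat W) (ofRel_cutOut_nonneg W)
    (Relation.ReflTransGen.mono (fun _ _ hab => ofRel_cutOut_ne_zero.2 hab) _ _ h)

theorem ofRel_var (s : V) : (ofRel F hF).var s = 1 := rfl

theorem errCov_ofRel_pos {f g : V → ℝ} (hf : ∀ s, 0 ≤ f s) (hg : ∀ s, 0 ≤ g s)
    (h : ∃ s, 0 < f s ∧ 0 < g s) : 0 < errCov (ofRel F hF).var f g := by
  obtain ⟨s, h1, h2⟩ := h
  refine Finset.sum_pos' (fun i _ => ?_) ⟨s, Finset.mem_univ _, ?_⟩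
  · rw [ofRel_var, one_mul]
    exact mul_nonneg (hf i) (hg i)
  · rw [ofRel_var, one_mul]
    exact mul_pos h1 h2

theorem ofRel_lastExit_nonneg (W : Set V) (v w : V) : 0 ≤ (ofRel F hF).coef.lastExit W v w := by
  rw [Matrix.lastExit_apply]
  split_ifs
  · exact Finset.sum_nonneg fun u _ =>
      mul_nonneg (ofRel_cutOut_total_nonneg W v u) (ofRel_coef_nonneg u w)
  · rfl

theorem ofRel_lastExit_pos {W : Set V} {v w : V} (hw : w ∈ W)
    (h : ∃ u, F w u ∧ Relation.ReflTransGen (fun a b => F a b ∧ a ∉ W) u v) :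
    0 < (ofRel F hF).coef.lastExit W v w := by
  obtain ⟨u, hu, huv⟩ := h
  rw [Matrix.lastExit_apply, if_pos hw]
  refine Finset.sum_pos' (fun u _ =>
      mul_nonneg (ofRel_cutOut_total_nonneg W v u) (ofRel_coef_nonneg u w))
    ⟨u, Finset.mem_univ _, mul_pos (ofRel_cutOut_total_pos huv) ?_⟩
  simp [ofRel_coef, hu]

end OfRel

theorem doMean_one_pos {X : Set V} {v : V} (hv : v ∈ D.Desc X) :
    0 < (ofRel D.Edge fun _ _ h => h : GaussianSEM V D).doMean X 1 v := by
  set S : GaussianSEM V D := ofRel D.Edge fun _ _ h => h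
  induction v using D.wellFounded_edge.induction with
  | _ v ih =>
    rw [doMean_eq]
    split_ifs with hvX
    · exact one_pos
    · obtain ⟨w, hw, hwv⟩ := hv
      have hnn : ∀ u, 0 ≤ S.coef v u * S.doMean X 1 u := fun u => by
        by_cases h : S.coef v u = 0
        · simp [h]
        · refine mul_nonneg (ofRel_coef_nonneg v u) ?_
          by_contra hneg
          exact hneg (ih u (S.compat _ _ h)
            (S.mem_desc_of_doMean_ne_zero X 1 fun h0 => hneg h0.ge)).le
      rcases hwv.cases_tail with rfl | ⟨u, hwu, huv⟩
      · exact absurd hw hvX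
      · refine Finset.sum_pos' (fun u _ => hnn u) ⟨u, Finset.mem_univ _, ?_⟩
        refine mul_pos ?_ (ih u huv ⟨w, hw, hwu⟩)
        rw [ofRel_coef, if_pos huv]
        exact one_pos

theorem exists_not_adjusts_of_mediated {X Z : Set V} {y : V} (hXZ : Disjoint X Z)
    (hy : y ∉ X ∪ Z) (hl : ∀ x ∈ X, ¬ D.Linked X Z y x) (hm : D.Mediated X Z y) :
    ∃ (S : GaussianSEM V D) (x : V → ℝ), ¬ S.Adjusts X Z x y := by
  set S : GaussianSEM V D := ofRel D.Edge fun _ _ h => h with hS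
  refine ⟨S, 1, fun h => ?_⟩
  obtain ⟨c, hc, hcX⟩ := S.exists_isRegression_of_not_linked hXZ hl
  rw [hc.adjusts_iff hXZ, S.doMean_eq_sum_lastExit X Z 1 hy] at h
  refine h.not_gt (Finset.sum_lt_sum (fun u _ => ?_) ?_)
  · split_ifs with hu
    · rw [hcX u hu, S.doMean_eq, if_pos hu]
    · by_cases h0 : S.doMean X 1 u = 0
      · simp [h0]
      · exact mul_nonneg (ofRel_lastExit_nonneg _ _ _)
          (doMean_one_pos (S.mem_desc_of_doMean_ne_zero X 1 h0)).le
  · obtain ⟨z, hzZ, hzX, hz⟩ := hm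
    refine ⟨z, Finset.mem_univ _, ?_⟩
    rw [if_neg (hXZ.notMem_of_mem_right hzZ)]
    exact mul_pos (ofRel_lastExit_pos (Or.inr hzZ) hz) (doMean_one_pos hzX)

/-- in a model without effects out of `Z`, valid adjustment identifies the regression coefficients
up to a combination supported on `Z` -/
theorem errCov_eq_of_adjusts {S : GaussianSEM V D} {X Z : Set V} {y : V} (hXZ : Disjoint X Z)
    (hy : y ∉ X ∪ Z) (hZ : ∀ z ∈ Z, ∀ v, S.coef v z = 0) (h : ∀ x, S.Adjusts X Z x y) :
    ∃ γ : V → ℝ, (∀ j, j ∉ Z → γ j = 0) ∧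
      ∀ w ∈ X ∪ Z, ∑ j, γ j * errCov S.var (S.coef.total j) (S.coef.total w)
        = errCov S.var ((S.coef.cutOut (X ∪ Z)).total y) (S.coef.total w) := by
  obtain ⟨c, hc⟩ := S.exists_isRegression y (X ∪ Z)
  have hκZ : ∀ z ∈ Z, S.coef.lastExit (X ∪ Z) y z = 0 := fun z hz => by
    simp [Matrix.lastExit_apply, hZ z hz]
  have hcX : ∀ j ∈ X, c j = S.coef.lastExit (X ∪ Z) y j := fun j hj => by
    have h1 := (hc.adjusts_iff hXZ (Pi.single j 1)).1 (h _)
    rw [S.doMean_eq_sum_lastExit X Z _ hy, Finset.sum_eq_single j, Finset.sum_eq_single j,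
      if_pos hj, S.doMean_eq, if_pos hj, Pi.single_eq_same, mul_one, mul_one] at h1
    · exact h1.symm
    · intro i _ hij
      simp [hij]
    · simp
    · intro i _ hij
      by_cases hiX : i ∈ X
      · rw [S.doMean_eq, if_pos hiX, Pi.single_eq_of_ne hij, mul_zero]
      · by_cases hiZ : i ∈ Z
        · rw [hκZ i hiZ, zero_mul]
        · rw [Matrix.lastExit_apply, if_neg (by simp [hiX, hiZ]), zero_mul]
    · simp
  refine ⟨fun j => c j - S.coef.lastExit (X ∪ Z) y j, fun j hj => ?_, fun w hw => ?_⟩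
  · beta_reduce
    by_cases hjX : j ∈ X
    · rw [hcX j hjX, sub_self]
    · rw [hc.eq_zero j (by simp [hjX, hj]), Matrix.lastExit_apply, if_neg (by simp [hjX, hj]),
        sub_self]
  · have h1 := hc.normal w hw
    simp only [cov_apply] at h1
    have h2 : errCov S.var (S.coef.total y) (S.coef.total w)
        = errCov S.var ((S.coef.cutOut (X ∪ Z)).total y) (S.coef.total w)
          + ∑ j, S.coef.lastExit (X ∪ Z) y j
            * errCov S.var (S.coef.total j) (S.coef.total w) := by
      simp only [errCov_comm S.var _ (S.coef.total w)]
      rw [← errCov_add_sum_right S.var (S.coef.total w) ((S.coef.cutOut (X ∪ Z)).total y) _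
        S.coef.total]
      congr 1
      funext s
      exact Matrix.total_apply_eq_cutOut_add S.compat (X ∪ Z) y s
    simp only [sub_mul, Finset.sum_sub_distrib]
    linarith

theorem exists_not_adjusts_of_linked {X Z : Set V} {y x : V} (hXZ : Disjoint X Z)
    (hy : y ∉ X ∪ Z) (hx : x ∈ X) (hl : D.Linked X Z y x) :
    ∃ (S : GaussianSEM V D) (x : V → ℝ), ¬ S.Adjusts X Z x y := by
  by_contra hcon
  push Not at hcon
  obtain ⟨k, t, ht0, ht, hlast, htrek⟩ := DAG.exists_shortest_linkChain hx hl
  have htW : ∀ i ≤ k, t i ∈ X ∪ Z := fun i hi => by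
    cases i with
    | zero => exact Or.inl ht0
    | succ i => exact Or.inr (ht.mem i hi)
  set F : V → V → Prop := fun u v => D.Edge u v ∧ u ∉ Z ∧ (v ∈ Z → ∃ i < k, t (i + 1) = v) with hF
  have hlift : ∀ s b, Relation.ReflTransGen (D.EdgeOff Z) s b →
      (b ∈ Z → ∃ i < k, t (i + 1) = b) → Relation.ReflTransGen F s b := by
    intro s b h
    induction h with
    | refl => exact fun _ => .refl
    | tail _ hbc ih => exact fun hc => (ih fun hb => absurd hb hbc.2).tail ⟨hbc.1, hbc.2, hc⟩
  have hFoff : ∀ s b, Relation.ReflTransGen F s b → Relation.ReflTransGen (D.EdgeOff Z) s b :=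
    fun s b h => Relation.ReflTransGen.mono (fun _ _ h => ⟨h.1, h.2.1⟩) _ _ h
  have htarget : ∀ i ≤ k, t i ∈ Z → ∃ m < k, t (m + 1) = t i := fun i hi hz => by
    cases i with
    | zero => exact absurd hz (hXZ.notMem_of_mem_left ht0)
    | succ i => exact ⟨i, hi, rfl⟩
  set S : GaussianSEM V D := ofRel F fun _ _ h => h.1 with hS
  obtain ⟨γ, hγ0, hγ⟩ := errCov_eq_of_adjusts (S := S) hXZ hy
    (fun z hz v => by simp [hS, ofRel_coef, hF, hz]) (hcon S)
  have hk0 : ∀ i < k, errCov S.var ((S.coef.cutOut (X ∪ Z)).total y) (S.coef.total (t i)) = 0 := by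
    intro i hi
    by_contra hne
    obtain ⟨s, hs1, hs2⟩ := exists_ne_zero_of_errCov_ne_zero hne
    exact hlast i hi ⟨s, hFoff _ _ (reflTransGen_of_ofRel_total_ne_zero hs2),
      DAG.reflTransGen_edgeOff_of_total_cutOut_ne_zero S.compat hs1⟩
  have hrow : ∀ i ≤ k, ∀ j ∈ Z, errCov S.var (S.coef.total j) (S.coef.total (t i)) ≠ 0 →
      ∃ m < k, t (m + 1) = j ∧ m ≤ i := by
    intro i hi j hj hne
    obtain ⟨s, hs1, hs2⟩ := exists_ne_zero_of_errCov_ne_zero hne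
    have h1 := reflTransGen_of_ofRel_total_ne_zero hs1
    have h2 := reflTransGen_of_ofRel_total_ne_zero hs2
    obtain ⟨m, hm, hmj⟩ : ∃ m < k, t (m + 1) = j := by
      rcases h1.cases_tail with rfl | ⟨u, -, huj⟩
      · rcases h2.cases_head with h | ⟨u, hju, -⟩
        · obtain ⟨m, hm, hmi⟩ := htarget i hi (h ▸ hj)
          exact ⟨m, hm, hmi.trans h.symm⟩
        · exact absurd hj hju.2.1
      · exact huj.2.2 hj
    refine ⟨m, hm, hmj, ?_⟩
    by_contra hmi
    exact htrek i (m + 1) (by omega) (by omega) ⟨s, hFoff _ _ h2, hmj ▸ hFoff _ _ h1⟩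
  have hγt : ∀ i < k, γ (t (i + 1)) = 0 := by
    intro i
    induction i using Nat.strong_induction_on with
    | _ i ih =>
      intro hi
      have h := hγ (t i) (htW i hi.le)
      rw [hk0 i hi, Finset.sum_eq_single (t (i + 1))] at h
      · refine (mul_eq_zero.1 h).resolve_right (ne_of_gt ?_)
        obtain ⟨s, h1, h2⟩ := ht.trek i hi
        exact errCov_ofRel_pos (ofRel_total_nonneg _) (ofRel_total_nonneg _)
          ⟨s, ofRel_total_pos (hlift _ _ h2 fun _ => ⟨i, hi, rfl⟩),
            ofRel_total_pos (hlift _ _ h1 (htarget i hi.le))⟩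
      · intro j _ hj
        by_contra hne
        have hjZ : j ∈ Z := by
          by_contra hjZ
          exact hne (by rw [hγ0 j hjZ, zero_mul])
        obtain ⟨m, hm, rfl, hmi⟩ := hrow i hi.le j hjZ (right_ne_zero_of_mul hne)
        rcases hmi.lt_or_eq with hlt | rfl
        · exact hne (by rw [ih m hlt hm, zero_mul])
        · exact hj rfl
      · simp
  have h := hγ (t k) (htW k le_rfl)
  rw [Finset.sum_eq_zero] at h
  · obtain ⟨s, h1, h2⟩ := ht.last
    refine h.not_lt (errCov_ofRel_pos (ofRel_cutOut_total_nonneg _ _) (ofRel_total_nonneg _)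
      ⟨s, ofRel_cutOut_total_pos ?_, ofRel_total_pos (hlift _ _ h1 (htarget k le_rfl))⟩)
    have : ∀ b, b ∉ Z → Relation.ReflTransGen (D.EdgeOff (X ∪ Z)) s b →
        Relation.ReflTransGen (fun a b => F a b ∧ a ∉ X ∪ Z) s b := by
      intro b hb hsb
      induction hsb with
      | refl => exact .refl
      | tail _ hbc ih =>
        have hbZ := fun h => hbc.2 (Or.inr h)
        exact (ih hbZ).tail ⟨⟨hbc.1, hbZ, fun h => absurd h hb⟩, hbc.2⟩
    exact this y (fun h => hy (Or.inr h)) h2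
  · intro j _
    by_contra hne
    have hjZ : j ∈ Z := by
      by_contra hjZ
      exact hne (by rw [hγ0 j hjZ, zero_mul])
    obtain ⟨m, hm, rfl, -⟩ := hrow k le_rfl j hjZ (right_ne_zero_of_mul hne)
    exact hne (by rw [hγt m hm, zero_mul])

end GaussianSEM

namespace List

variable {V : Type}

theorem triple_infix_map_range {f : ℕ → V} {n : ℕ} {a b c : V} :
    [a, b, c] <:+: (List.range (n + 1)).map f ↔
      ∃ i, i + 1 < n ∧ f i = a ∧ f (i + 1) = b ∧ f (i + 2) = c := by
  rw [List.infix_iff_getElem?]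
  constructor
  · rintro ⟨k, hk, h⟩
    simp only [List.length_cons, List.length_nil, List.length_map, List.length_range] at hk
    have h0 := h 0 (by simp)
    have h1 := h 1 (by simp)
    have h2 := h 2 (by simp)
    refine ⟨k, by omega, ?_, ?_, ?_⟩
    · simpa [List.getElem?_range (show k < n + 1 by omega)] using h0
    · simpa [List.getElem?_range (show k + 1 < n + 1 by omega), add_comm] using h1
    · simpa [List.getElem?_range (show k + 2 < n + 1 by omega), add_comm] using h2
  · rintro ⟨i, hi, rfl, rfl, rfl⟩
    refine ⟨i, by simp; omega, fun j hj => ?_⟩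
    simp only [List.length_cons, List.length_nil] at hj
    interval_cases j
    · simp [List.getElem?_range (show i < n + 1 by omega)]
    · simp [List.getElem?_range (show i + 1 < n + 1 by omega), add_comm]
    · simp [List.getElem?_range (show i + 2 < n + 1 by omega), add_comm]

theorem isChain_map_range {R : V → V → Prop} {f : ℕ → V} {n : ℕ} :
    ((List.range (n + 1)).map f).IsChain R ↔ ∀ i < n, R (f i) (f (i + 1)) := by
  rw [List.isChain_iff_getElem]
  simp

theorem mem_tail_map_range {f : ℕ → V} {n : ℕ} {v : V} :
    v ∈ ((List.range (n + 1)).map f).tail ↔ ∃ i < n, f (i + 1) = v := by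
  rw [List.range_succ_eq_map]
  simp

theorem exists_eq_map_range {p : List V} {x : V} (h : p.head? = some x) :
    ∃ f n, p = (List.range (n + 1)).map f ∧ f 0 = x := by
  cases p with
  | nil => simp at h
  | cons a l =>
    refine ⟨fun i => (a :: l).getD i a, l.length, ?_, by simpa using h⟩
    refine List.ext_getElem (by simp) fun i h1 h2 => ?_
    simp at h1
    simp [h1]

end List

namespace DAG

variable {V : Type} [Fintype V] [DecidableEq V] {D : DAG V}

/-- a walk along `f 0, …, f n` that is d-connecting given `Z` -/
structure ActiveWalk (D : DAG V) (Z : Set V) (f : ℕ → V) (n : ℕ) : Prop where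
  adj : ∀ i < n, D.Adj (f i) (f (i + 1))
  collider : ∀ i, i + 1 < n → D.Edge (f i) (f (i + 1)) → D.Edge (f (i + 2)) (f (i + 1)) →
    ∃ z ∈ Z, Relation.ReflTransGen D.Edge (f (i + 1)) z
  nonCollider : ∀ i, i + 1 < n → f (i + 1) ∈ Z →
    D.Edge (f i) (f (i + 1)) ∧ D.Edge (f (i + 2)) (f (i + 1))

/-- an active walk from `X` to `Y` that is proper and non-causal -/
structure ConnectingWalk (D : DAG V) (X Y Z : Set V) (f : ℕ → V) (n : ℕ) : Prop
    extends D.ActiveWalk Z f n where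
  start_mem : f 0 ∈ X
  end_mem : f n ∈ Y
  proper : ∀ i < n, f (i + 1) ∉ X
  nonCausal : ∃ i < n, ¬ D.Edge (f i) (f (i + 1))

theorem blocks_map_range_iff {Z : Set V} {f : ℕ → V} {n : ℕ} (hf : Set.InjOn f (Set.Iic n)) :
    ¬ D.Blocks Z ((List.range (n + 1)).map f) ↔
      (∀ i, i + 1 < n → D.Edge (f i) (f (i + 1)) → D.Edge (f (i + 2)) (f (i + 1)) →
        ∃ z ∈ Z, Relation.ReflTransGen D.Edge (f (i + 1)) z) ∧
      (∀ i, i + 1 < n → f (i + 1) ∈ Z →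
        D.Edge (f i) (f (i + 1)) ∧ D.Edge (f (i + 2)) (f (i + 1))) := by
  have hcol : ∀ i, i + 1 < n → (D.IsColliderOn ((List.range (n + 1)).map f) (f (i + 1)) ↔
      D.Edge (f i) (f (i + 1)) ∧ D.Edge (f (i + 2)) (f (i + 1))) := by
    intro i hi
    constructor
    · rintro ⟨a, b, hab, h1, h2⟩
      obtain ⟨j, hj, rfl, hji, rfl⟩ := List.triple_infix_map_range.1 hab
      obtain rfl : j = i := by
        have := hf (x₁ := j + 1) (x₂ := i + 1) (by simp; omega) (by simp; omega) hji
        omega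
      exact ⟨h1, h2⟩
    · rintro ⟨h1, h2⟩
      exact ⟨_, _, List.triple_infix_map_range.2 ⟨i, hi, rfl, rfl, rfl⟩, h1, h2⟩
  constructor
  · intro h
    refine ⟨fun i hi h1 h2 => ?_, fun i hi hz => ?_⟩
    · by_contra hcon
      refine h (Or.inr ⟨f (i + 1), (hcol i hi).2 ⟨h1, h2⟩, ?_⟩)
      ext v
      simp only [DAG.Desc, Set.mem_singleton_iff, exists_eq_left, Set.mem_inter_iff,
        Set.mem_ofPred_eq, Set.mem_empty_iff_false, iff_false, not_and]
      exact fun h1 h2 => hcon ⟨v, h2, h1⟩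
    · by_contra hcon
      exact h (Or.inl ⟨f (i + 1), ⟨⟨_, _, List.triple_infix_map_range.2 ⟨i, hi, rfl, rfl, rfl⟩⟩,
        fun hc => hcon ((hcol i hi).1 hc)⟩, hz⟩)
  · rintro ⟨hc, hn⟩ (⟨w, ⟨⟨a, b, hab⟩, hw⟩, hz⟩ | ⟨w, ⟨a, b, hab, h1, h2⟩, hz⟩)
    · obtain ⟨i, hi, rfl, rfl, rfl⟩ := List.triple_infix_map_range.1 hab
      exact hw ((hcol i hi).2 (hn i hi hz))
    · obtain ⟨i, hi, rfl, rfl, rfl⟩ := List.triple_infix_map_range.1 hab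
      obtain ⟨z, hzZ, hz'⟩ := hc i hi h1 h2
      exact Set.notMem_empty z (hz ▸ ⟨⟨_, rfl, hz'⟩, hzZ⟩)

theorem exists_connectingWalk {X Y Z : Set V} {p : List V} (hp : D.ProperNonCausalPath X Y p)
    (hb : ¬ D.Blocks Z p) : ∃ f n, D.ConnectingWalk X Y Z f n := by
  obtain ⟨⟨x, hx, y, hy, hnd, hadj, hh, hl⟩, hpr, hnc⟩ := hp
  obtain ⟨f, n, rfl, rfl⟩ := List.exists_eq_map_range hh
  have hinj : Set.InjOn f (Set.Iic n) := by
    intro i hi j hj hij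
    exact List.inj_on_of_nodup_map hnd (by simpa [Nat.lt_succ_iff] using hi)
      (by simpa [Nat.lt_succ_iff] using hj) hij
  obtain ⟨hc, hn⟩ := (blocks_map_range_iff hinj).1 hb
  refine ⟨f, n, ⟨⟨List.isChain_map_range.1 hadj, hc, hn⟩, hx, ?_,
    fun i hi => hpr _ (List.mem_tail_map_range.2 ⟨i, hi, rfl⟩), ?_⟩⟩
  · rw [List.range_succ] at hl
    simp at hl
    rwa [hl]
  · by_contra hcon
    push Not at hcon
    exact hnc (List.isChain_map_range.2 hcon)

theorem ConnectingWalk.exists_path {X Y Z : Set V} {f : ℕ → V} {n : ℕ}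
    (h : D.ConnectingWalk X Y Z f n) (hf : Set.InjOn f (Set.Iic n)) :
    ∃ p, D.ProperNonCausalPath X Y p ∧ ¬ D.Blocks Z p := by
  refine ⟨(List.range (n + 1)).map f, ⟨⟨f 0, h.start_mem, f n, h.end_mem, ?_,
    List.isChain_map_range.2 h.adj, ?_, ?_⟩, ?_, ?_⟩,
    (blocks_map_range_iff hf).2 ⟨h.collider, h.nonCollider⟩⟩
  · refine List.Nodup.map_on (fun i hi j hj hij => hf ?_ ?_ hij) List.nodup_range
    · simpa [Nat.lt_succ_iff] using hi
    · simpa [Nat.lt_succ_iff] using hj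
  · rw [List.range_succ_eq_map]
    simp
  · rw [List.range_succ]
    simp
  · intro v hv
    obtain ⟨i, hi, rfl⟩ := List.mem_tail_map_range.1 hv
    exact h.proper i hi
  · obtain ⟨i, hi, hne⟩ := h.nonCausal
    exact fun hc => hne (List.isChain_map_range.1 hc i hi)

end DAG

namespace DAG

variable {V : Type} [Fintype V] [DecidableEq V] {D : DAG V}

/-- edges of `D` that leave a node off `Z` and enter a node off `X` -/
def EdgeBetween (D : DAG V) (X Z : Set V) (a b : V) : Prop := D.Edge a b ∧ a ∉ Z ∧ b ∉ X

theorem EdgeBetween.reflTransGen_edgeOff {X Z : Set V} {a b : V}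
    (h : Relation.ReflTransGen (D.EdgeBetween X Z) a b) :
    Relation.ReflTransGen (D.EdgeOff Z) a b :=
  Relation.ReflTransGen.mono (fun _ _ h => ⟨h.1, h.2.1⟩) _ _ h

theorem EdgeBetween.reflTransGen {X Z : Set V} {a b : V}
    (h : Relation.ReflTransGen (D.EdgeBetween X Z) a b) : Relation.ReflTransGen D.Edge a b :=
  Relation.ReflTransGen.mono (fun _ _ h => h.1) _ _ h

theorem EdgeBetween.reflTransGen_edgeOff_union {X Z : Set V} {a b : V} (ha : a ∉ X)
    (h : Relation.ReflTransGen (D.EdgeBetween X Z) a b) :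
    Relation.ReflTransGen (D.EdgeOff (X ∪ Z)) a b := by
  induction h using Relation.ReflTransGen.head_induction_on with
  | refl => exact .refl
  | head hac _ ih => exact (ih hac.2.2).head ⟨hac.1, by simp [ha, hac.2.1]⟩

theorem EdgeOff.mono {W W' : Set V} (hW : W ⊆ W') {a b : V}
    (h : Relation.ReflTransGen (D.EdgeOff W') a b) : Relation.ReflTransGen (D.EdgeOff W) a b :=
  Relation.ReflTransGen.mono (fun _ _ h => ⟨h.1, fun hW' => h.2 (hW hW')⟩) _ _ h

theorem EdgeBetween.avoids_or_exists_last {X Z : Set V} {a b : V}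
    (h : Relation.ReflTransGen (D.EdgeBetween X ∅) a b) :
    Relation.ReflTransGen (D.EdgeBetween X Z) a b ∨
      ∃ z ∈ Z, ∃ v, Relation.ReflTransGen D.Edge a z ∧ D.Edge z v ∧ v ∉ X ∧
        Relation.ReflTransGen (D.EdgeBetween X Z) v b := by
  induction h with
  | refl => exact Or.inl .refl
  | @tail b c hab hbc ih =>
    by_cases hb : b ∈ Z
    · exact Or.inr ⟨b, hb, c, EdgeBetween.reflTransGen hab, hbc.1, hbc.2.2, .refl⟩
    · rcases ih with ih | ⟨z, hz, v, h1, h2, h3, h4⟩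
      · exact Or.inl (ih.tail ⟨hbc.1, hb, hbc.2.2⟩)
      · exact Or.inr ⟨z, hz, v, h1, h2, h3, h4.tail ⟨hbc.1, hb, hbc.2.2⟩⟩

theorem exists_first_mem {W : Set V} {a z : V} (h : Relation.ReflTransGen D.Edge a z)
    (hz : z ∈ W) : ∃ t ∈ W, Relation.ReflTransGen (D.EdgeOff W) a t ∧
      Relation.ReflTransGen D.Edge t z := by
  induction h using Relation.ReflTransGen.head_induction_on with
  | refl => exact ⟨z, hz, .refl, .refl⟩
  | @head a c hac hcz ih =>
    by_cases ha : a ∈ W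
    · exact ⟨a, ha, .refl, hcz.head hac⟩
    · obtain ⟨t, ht, h1, h2⟩ := ih
      exact ⟨t, ht, h1.head ⟨hac, ha⟩, h2⟩

theorem exists_paths_of_mem_forb {X Y : Set V} {z : V} (hz : z ∈ D.Forb X Y) :
    ∃ x ∈ X, ∃ y ∈ Y, ∃ w, w ∉ X ∧ Relation.ReflTransGen (D.EdgeBetween X ∅) x w ∧
      Relation.ReflTransGen (D.EdgeBetween X ∅) w y ∧ Relation.ReflTransGen D.Edge w z := by
  obtain ⟨p, w, ⟨⟨x, hx, y, hy, -, -, hh, hl⟩, hpr, hc⟩, hwp, hwX, hwz⟩ := hz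
  obtain ⟨f, n, rfl, rfl⟩ := List.exists_eq_map_range hh
  have hc' := List.isChain_map_range.1 hc
  have hstep : ∀ i < n, D.EdgeBetween X ∅ (f i) (f (i + 1)) := fun i hi =>
    ⟨hc' i hi, id, hpr _ (List.mem_tail_map_range.2 ⟨i, hi, rfl⟩)⟩
  have hreach : ∀ i j, i ≤ j → j ≤ n →
      Relation.ReflTransGen (D.EdgeBetween X ∅) (f i) (f j) := by
    intro i j hij
    induction j, hij using Nat.le_induction with
    | base => exact fun _ => .refl
    | succ j _ ih => exact fun hj => (ih (by omega)).tail (hstep j hj)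
  obtain ⟨i, hi, rfl⟩ := List.mem_map.1 hwp
  have hin : i ≤ n := by simpa [Nat.lt_succ_iff] using hi
  refine ⟨f 0, hx, f n, ?_, f i, hwX, hreach 0 i (by omega) hin, hreach i n hin le_rfl, hwz⟩
  rw [List.range_succ] at hl
  simp at hl
  rwa [hl]

theorem forb_disjoint {X Y Z : Set V}
    (hl : ∀ y ∈ Y, ∀ x ∈ X, ¬ D.Linked X Z y x) (hm : ∀ y ∈ Y, ¬ D.Mediated X Z y) :
    Z ∩ D.Forb X Y = ∅ := by
  rw [Set.eq_empty_iff_forall_notMem]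
  rintro z ⟨hzZ, hzF⟩
  obtain ⟨x, hx, y, hy, w, hw, hxw, hwy, hwz⟩ := exists_paths_of_mem_forb hzF
  rcases EdgeBetween.avoids_or_exists_last (Z := Z) hwy with hwy' | ⟨z', hz', v, h1, h2, h3, h4⟩
  · have hwy'' := EdgeBetween.reflTransGen_edgeOff_union hw hwy'
    obtain ⟨t, ht, hwt, -⟩ := exists_first_mem hwz (Set.mem_union_right X hzZ)
    have hwt' := EdgeOff.mono Set.subset_union_right hwt
    rcases ht with ht | ht
    · exact hl y hy t ht (.base ⟨w, hwt', hwy''⟩)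
    · rcases EdgeBetween.avoids_or_exists_last (Z := Z) hxw with
        hxw' | ⟨z', hz', v, h1, h2, h3, h4⟩
      · exact hl y hy x hx (.step (.base ⟨w, hwt', hwy''⟩) ht
          ⟨x, (EdgeBetween.reflTransGen_edgeOff hxw').trans hwt', .refl⟩)
      · exact hm y hy ⟨z', hz', ⟨x, hx, h1⟩, v, h2,
          EdgeBetween.reflTransGen_edgeOff_union h3 (h4.trans hwy')⟩
  · exact hm y hy ⟨z', hz', ⟨x, hx, (EdgeBetween.reflTransGen hxw).trans h1⟩, v, h2,
      EdgeBetween.reflTransGen_edgeOff_union h3 h4⟩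

/-- any node to which `a` is linked has a link from `X` -/
def Reached (D : DAG V) (X Z : Set V) (a : V) : Prop :=
  ∀ y, D.Linked X Z y a → ∃ x ∈ X, D.Linked X Z y x

theorem Reached.of_trek {X Z : Set V} {a b : V} (ha : D.Reached X Z a) (hb : b ∈ Z)
    (h : D.Trek Z a b) : D.Reached X Z b :=
  fun y hy => ha y (.step hy hb h.symm)

theorem ConnectingWalk.exists_linked {X Y Z : Set V} {f : ℕ → V} {n : ℕ}
    (h : D.ConnectingWalk X Y Z f n) (hXZ : Disjoint X Z) (hYZ : Disjoint Y Z) :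
    ∃ x ∈ X, D.Linked X Z (f n) x := by
  have hX : ∀ x ∈ X, D.Reached X Z x := fun x hx y hy => ⟨x, hx, hy⟩
  have hback : ∀ i < n, D.Edge (f (i + 1)) (f i) → f (i + 1) ∉ X ∪ Z := by
    rintro i hi he (hx | hz)
    · exact h.proper i hi hx
    · rcases Nat.lt_or_ge (i + 1) n with hin | hin
      · exact D.acyclic _ (.tail (.single he) (h.nonCollider i hin hz).1)
      · obtain rfl : n = i + 1 := by omega
        exact hYZ.notMem_of_mem_left h.end_mem hz
  have key : ∀ i < n,
      (D.Edge (f i) (f (i + 1)) ∧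
        (((∀ j ≤ i, D.Edge (f j) (f (j + 1))) ∧
          ∃ x ∈ X, Relation.ReflTransGen (D.EdgeOff Z) x (f (i + 1))) ∨
        ∃ a, D.Reached X Z a ∧ D.TrekTo X Z (f (i + 1)) a)) ∨
      (D.Edge (f (i + 1)) (f i) ∧
        ∃ a, D.Reached X Z a ∧ Relation.ReflTransGen (D.EdgeOff Z) (f (i + 1)) a) := by
    intro i
    induction i with
    | zero =>
      intro hi
      rcases h.adj 0 hi with he | he
      · refine Or.inl ⟨he, Or.inl ⟨fun j hj => ?_, f 0, h.start_mem,
          .single ⟨he, hXZ.notMem_of_mem_left h.start_mem⟩⟩⟩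
        obtain rfl : j = 0 := by omega
        exact he
      · exact Or.inr ⟨he, f 0, hX _ h.start_mem,
          .single ⟨he, fun hz => hback 0 hi he (Or.inr hz)⟩⟩
    | succ i ih =>
      intro hi
      have hadj := h.adj (i + 1) hi
      rcases ih (by omega) with ⟨he, hs⟩ | ⟨he, a, ha, hva⟩
      · rcases hadj with he' | he'
        · have hoff : f (i + 1) ∉ X ∪ Z := by
            rintro (hx | hz)
            · exact h.proper i (by omega) hx
            · exact D.acyclic _ (.tail (.single he') (h.nonCollider i hi hz).2)
          refine Or.inl ⟨he', ?_⟩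
          rcases hs with ⟨hall, x, hx, hxv⟩ | ⟨a, ha, s, hsa, hsv⟩
          · refine Or.inl ⟨fun j hj => ?_, x, hx, hxv.tail ⟨he', fun hz => hoff (Or.inr hz)⟩⟩
            rcases Nat.lt_or_ge j (i + 1) with hji | hji
            · exact hall j (by omega)
            · obtain rfl : j = i + 1 := by omega
              exact he'
          · exact Or.inr ⟨a, ha, s, hsa, hsv.tail ⟨he', hoff⟩⟩
        · refine Or.inr ⟨he', ?_⟩
          obtain ⟨z, hz, hvz⟩ := h.collider i hi he he'
          obtain ⟨t, ht, hvt, -⟩ := exists_first_mem hvz hz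
          refine ⟨t, ?_, hvt.head ⟨he', fun hz => hback (i + 1) hi he' (Or.inr hz)⟩⟩
          rcases hs with ⟨-, x, hx, hxv⟩ | ⟨a, ha, s, hsa, hsv⟩
          · exact (hX x hx).of_trek ht ⟨x, .refl, hxv.trans hvt⟩
          · exact ha.of_trek ht ⟨s, hsa, (EdgeOff.mono Set.subset_union_right hsv).trans hvt⟩
      · have hoff := hback i (by omega) he
        rcases hadj with he' | he'
        · exact Or.inl ⟨he', Or.inr ⟨a, ha, f (i + 1), hva, .single ⟨he', hoff⟩⟩⟩
        · exact Or.inr ⟨he', a, ha,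
            hva.head ⟨he', fun hz => hback (i + 1) hi he' (Or.inr hz)⟩⟩
  obtain ⟨i, hi, hne⟩ := h.nonCausal
  obtain ⟨m, rfl⟩ : ∃ m, n = m + 1 := ⟨n - 1, by omega⟩
  rcases key m (by omega) with ⟨-, ⟨hall, -⟩ | ⟨a, ha, hay⟩⟩ | ⟨-, a, ha, hya⟩
  · exact absurd (hall i (by omega)) hne
  · exact ha _ (.base hay)
  · exact ha _ (.base ⟨_, hya, .refl⟩)

theorem satisfiesAC_of_not_linked {X Y Z : Set V} (hXZ : Disjoint X Z) (hYZ : Disjoint Y Z)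
    (hl : ∀ y ∈ Y, ∀ x ∈ X, ¬ D.Linked X Z y x) (hm : ∀ y ∈ Y, ¬ D.Mediated X Z y) :
    D.SatisfiesAC X Y Z := by
  refine ⟨forb_disjoint hl hm, fun p hp => ?_⟩
  by_contra hb
  obtain ⟨f, n, h⟩ := exists_connectingWalk hp hb
  obtain ⟨x, hx, hlx⟩ := h.exists_linked hXZ hYZ
  exact hl _ h.end_mem x hx hlx

end DAG

namespace DAG

variable {V : Type} [Fintype V] [DecidableEq V] {D : DAG V}

theorem mem_forb {X Y : Set V} {x y v z : V} (hx : x ∈ X) (hy : y ∈ Y) (hv : v ∉ X)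
    (hxv : Relation.ReflTransGen (D.EdgeBetween X ∅) x v)
    (hvy : Relation.ReflTransGen (D.EdgeBetween X ∅) v y)
    (hvz : Relation.ReflTransGen D.Edge v z) : z ∈ D.Forb X Y := by
  have h1 : ∃ l : List V, (v :: l).IsChain D.Edge ∧ (v :: l).getLast? = some y ∧
      v ∈ v :: l ∧ ∀ u ∈ l, u ∉ X := by
    clear hxv hv hvz
    induction hvy using Relation.ReflTransGen.head_induction_on with
    | refl => exact ⟨[], by simp⟩
    | @head a c hac _ ih =>
      obtain ⟨l, h1, h2, -, h4⟩ := ih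
      exact ⟨c :: l, h1.cons_cons hac.1, by simpa using h2, by simp, by
        simpa using ⟨hac.2.2, h4⟩⟩
  have h2 : ∃ l : List V, (x :: l).IsChain D.Edge ∧ (x :: l).getLast? = some y ∧
      v ∈ x :: l ∧ ∀ u ∈ l, u ∉ X := by
    clear hx
    induction hxv using Relation.ReflTransGen.head_induction_on with
    | refl => exact h1
    | @head a c hac _ ih =>
      obtain ⟨l, h1, h2, h3, h4⟩ := ih
      exact ⟨c :: l, h1.cons_cons hac.1, by simpa using h2, List.mem_cons_of_mem _ h3, by
        simpa using ⟨hac.2.2, h4⟩⟩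
  obtain ⟨l, hc, hl, hvl, hlX⟩ := h2
  refine ⟨x :: l, v, ⟨⟨x, hx, y, hy, ?_, hc.imp fun _ _ h => Or.inl h, rfl, hl⟩, hlX, hc⟩, hvl,
    hv, hvz⟩
  have hpw : (x :: l).Pairwise (Relation.TransGen D.Edge) :=
    List.isChain_iff_pairwise.1 (hc.imp fun _ _ h => Relation.TransGen.single h)
  refine hpw.imp ?_
  rintro a _ h rfl
  exact D.acyclic a h

theorem exists_last_mem {X : Set V} {x v : V} (hx : x ∈ X)
    (h : Relation.ReflTransGen D.Edge x v) :
    ∃ x' ∈ X, Relation.ReflTransGen (D.EdgeBetween X ∅) x' v := by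
  induction h with
  | refl => exact ⟨x, hx, .refl⟩
  | @tail b c _ hbc ih =>
    by_cases hc : c ∈ X
    · exact ⟨c, hc, .refl⟩
    · obtain ⟨x', hx', h⟩ := ih
      exact ⟨x', hx', h.tail ⟨hbc, id, hc⟩⟩

theorem EdgeOff.edgeBetween {X Z : Set V} {a b : V} (hb : b ∉ X ∪ Z)
    (h : Relation.ReflTransGen (D.EdgeOff (X ∪ Z)) a b) :
    a ∉ X ∧ Relation.ReflTransGen (D.EdgeBetween X ∅) a b := by
  induction h using Relation.ReflTransGen.head_induction_on with
  | refl => exact ⟨fun h => hb (Or.inl h), .refl⟩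
  | head hac _ ih => exact ⟨fun h => hac.2 (Or.inl h), ih.2.head ⟨hac.1, id, ih.1⟩⟩

theorem not_mediated {X Y Z : Set V} {y : V} (hXZ : Disjoint X Z) (hy : y ∈ Y) (hyW : y ∉ X ∪ Z)
    (hF : Z ∩ D.Forb X Y = ∅) : ¬ D.Mediated X Z y := by
  rintro ⟨z, hz, ⟨x, hx, hxz⟩, v, hzv, hvy⟩
  obtain ⟨x', hx', hx'z⟩ := exists_last_mem hx hxz
  obtain ⟨hvX, hvy'⟩ := EdgeOff.edgeBetween hyW hvy
  exact Set.notMem_empty z (hF ▸ ⟨hz, mem_forb hx' hy (hXZ.notMem_of_mem_right hz) hx'z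
    (hvy'.head ⟨hzv, id, hvX⟩) .refl⟩)

/-- a d-connecting walk to `y` with a backward edge that is not followed by a node of `X` -/
structure TaggedWalk (D : DAG V) (X Z : Set V) (y : V) (f : ℕ → V) (n : ℕ) : Prop
    extends D.ActiveWalk Z f n where
  end_eq : f n = y
  tag : ∃ m < n, D.Edge (f (m + 1)) (f m) ∧ ∀ j, m < j → j ≤ n → f j ∉ X

/-- the walk `f` with the node `u` put in front -/
def consWalk (u : V) (f : ℕ → V) : ℕ → V := fun i => Nat.casesOn i u f

theorem TaggedWalk.cons {X Z : Set V} {y u : V} {f : ℕ → V} {n : ℕ}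
    (h : D.TaggedWalk X Z y f n) (hadj : D.Adj u (f 0))
    (hc : D.Edge u (f 0) → D.Edge (f 1) (f 0) → ∃ z ∈ Z, Relation.ReflTransGen D.Edge (f 0) z)
    (hn : f 0 ∈ Z → D.Edge u (f 0) ∧ D.Edge (f 1) (f 0)) :
    D.TaggedWalk X Z y (consWalk u f) (n + 1) := by
  refine ⟨⟨fun i hi => ?_, fun i hi => ?_, fun i hi => ?_⟩, h.end_eq, ?_⟩
  · cases i with
    | zero => exact hadj
    | succ i => exact h.adj i (by omega)
  · cases i with
    | zero => exact hc
    | succ i => exact h.collider i (by omega)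
  · cases i with
    | zero => exact hn
    | succ i => exact h.nonCollider i (by omega)
  · obtain ⟨m, hm, he, hX⟩ := h.tag
    refine ⟨m + 1, by omega, he, fun j hj hjn => ?_⟩
    cases j with
    | zero => omega
    | succ j => exact hX j (by omega) (by omega)

/-- `v` has a tagged walk to `y` -/
def Conn (D : DAG V) (X Z : Set V) (y v : V) : Prop := ∃ f n, D.TaggedWalk X Z y f n ∧ f 0 = v

/-- `v` has a tagged walk to `y` whose first edge points into `v` -/
def ConnInto (D : DAG V) (X Z : Set V) (y v : V) : Prop :=
  ∃ f n, D.TaggedWalk X Z y f n ∧ f 0 = v ∧ D.Edge (f 1) (f 0)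

/-- `v` has a tagged walk to `y` whose first edge points out of `v` -/
def ConnOut (D : DAG V) (X Z : Set V) (y v : V) : Prop :=
  ∃ f n, D.TaggedWalk X Z y f n ∧ f 0 = v ∧ D.Edge (f 0) (f 1)

theorem ConnInto.conn {X Z : Set V} {y v : V} (h : D.ConnInto X Z y v) : D.Conn X Z y v := by
  obtain ⟨f, n, h, h0, -⟩ := h
  exact ⟨f, n, h, h0⟩

theorem ConnOut.conn {X Z : Set V} {y v : V} (h : D.ConnOut X Z y v) : D.Conn X Z y v := by
  obtain ⟨f, n, h, h0, -⟩ := h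
  exact ⟨f, n, h, h0⟩

theorem Conn.into {X Z : Set V} {y v u : V} (h : D.Conn X Z y v) (hvu : D.EdgeOff Z v u) :
    D.ConnInto X Z y u := by
  obtain ⟨f, n, h, rfl⟩ := h
  exact ⟨consWalk u f, n + 1, h.cons (Or.inr hvu.1)
    (fun he => absurd (.tail (.single he) hvu.1) (D.acyclic u))
    (fun hz => absurd hz hvu.2), rfl, hvu.1⟩

theorem ConnInto.out {X Z : Set V} {y t u : V} (h : D.ConnInto X Z y t) (ht : t ∈ Z)
    (hut : D.Edge u t) : D.ConnOut X Z y u := by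
  obtain ⟨f, n, h, rfl, he⟩ := h
  exact ⟨consWalk u f, n + 1, h.cons (Or.inl hut) (fun _ _ => ⟨_, ht, .refl⟩)
    (fun _ => ⟨hut, he⟩), rfl, hut⟩

theorem ConnOut.out {X Z : Set V} {y v u : V} (h : D.ConnOut X Z y v) (hv : v ∉ Z)
    (huv : D.Edge u v) : D.ConnOut X Z y u := by
  obtain ⟨f, n, h, rfl, he⟩ := h
  exact ⟨consWalk u f, n + 1, h.cons (Or.inl huv)
    (fun _ he' => absurd (.tail (.single he) he') (D.acyclic _)) (fun hz => absurd hz hv), rfl, huv⟩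

theorem Conn.into_of_reflTransGen {X Z : Set V} {y v a : V} (h : D.Conn X Z y v)
    (hva : Relation.ReflTransGen (D.EdgeOff Z) v a) : a = v ∨ D.ConnInto X Z y a := by
  induction hva with
  | refl => exact Or.inl rfl
  | tail _ hbc ih =>
    rcases ih with rfl | ih
    · exact Or.inr (h.into hbc)
    · exact Or.inr (ih.conn.into hbc)

theorem ConnInto.out_of_reflTransGen {X Z : Set V} {y s t : V} (h : D.ConnInto X Z y t)
    (ht : t ∈ Z) (hst : Relation.ReflTransGen (D.EdgeOff Z) s t) :
    s = t ∨ s ∉ Z ∧ D.ConnOut X Z y s := by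
  induction hst using Relation.ReflTransGen.head_induction_on with
  | refl => exact Or.inl rfl
  | head hac _ ih =>
    rcases ih with rfl | ⟨hc, ih⟩
    · exact Or.inr ⟨hac.2, h.out ht hac.1⟩
    · exact Or.inr ⟨hac.2, ih.out hc hac.1⟩

theorem EdgeOff.exists_walk {W : Set V} {s y : V} (hy : y ∉ W)
    (h : Relation.ReflTransGen (D.EdgeOff W) s y) :
    ∃ f : ℕ → V, ∃ n, f 0 = s ∧ f n = y ∧ (∀ i < n, D.Edge (f i) (f (i + 1))) ∧
      ∀ i ≤ n, f i ∉ W := by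
  induction h using Relation.ReflTransGen.head_induction_on with
  | refl => exact ⟨fun _ => y, 0, rfl, rfl, by simp, fun _ _ => hy⟩
  | @head a c hac _ ih =>
    obtain ⟨f, n, rfl, hn, h1, h2⟩ := ih
    refine ⟨consWalk a f, n + 1, rfl, hn, fun i hi => ?_, fun i hi => ?_⟩
    · cases i with
      | zero => exact hac.1
      | succ i => exact h1 i (by omega)
    · cases i with
      | zero => exact hac.2
      | succ i => exact h2 i (by omega)

theorem connInto_of_edge {X Z : Set V} {y s u : V} (hy : y ∉ X ∪ Z)
    (h : Relation.ReflTransGen (D.EdgeOff (X ∪ Z)) s y) (hsu : D.Edge s u) :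
    D.ConnInto X Z y u := by
  obtain ⟨f, n, rfl, hn, h1, h2⟩ := EdgeOff.exists_walk hy h
  have hX : ∀ i ≤ n, f i ∉ X := fun i hi h => h2 i hi (Or.inl h)
  have hZ : ∀ i ≤ n, f i ∉ Z := fun i hi h => h2 i hi (Or.inr h)
  refine ⟨consWalk u f, n + 1, ⟨⟨fun i hi => ?_, fun i hi _ he => ?_, fun i hi hz => ?_⟩, hn,
    0, by omega, hsu, fun j hj hjn => ?_⟩, rfl, hsu⟩
  · cases i with
    | zero => exact Or.inr hsu
    | succ i => exact Or.inl (h1 i (by omega))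
  · exact absurd (.tail (.single (h1 i (by omega))) he) (D.acyclic _)
  · exact absurd hz (hZ i (by omega))
  · cases j with
    | zero => omega
    | succ j => exact hX j (by omega)

theorem Linked.connInto_or {X Z : Set V} {y a : V} (hXZ : Disjoint X Z) (hy : y ∉ X ∪ Z)
    (h : D.Linked X Z y a) (ha : a ∈ X ∪ Z) :
    D.ConnInto X Z y a ∨ a ∈ X ∧ D.Conn X Z y a := by
  induction h with
  | @base a h =>
    obtain ⟨s, hsa, hsy⟩ := h
    rcases hsa.cases_head with rfl | ⟨u, hsu, hua⟩
    · rcases hsy.cases_head with rfl | ⟨u, hsu, -⟩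
      · exact absurd ha hy
      · exact absurd ha hsu.2
    · have hu := connInto_of_edge hy hsy hsu.1
      rcases hu.conn.into_of_reflTransGen hua with rfl | h
      · exact Or.inl hu
      · exact Or.inl h
  | @step z a _ hz ht ih =>
    have hz' : D.ConnInto X Z y z :=
      (ih (Or.inr hz)).resolve_right fun h => hXZ.notMem_of_mem_left h.1 hz
    obtain ⟨s, hsz, hsa⟩ := ht
    rcases hz'.out_of_reflTransGen hz hsz with rfl | ⟨hs, hout⟩
    · rcases hsa.cases_head with rfl | ⟨u, hsu, -⟩
      · exact Or.inl hz'
      · exact absurd hz hsu.2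
    · rcases hout.conn.into_of_reflTransGen hsa with rfl | h
      · exact Or.inr ⟨ha.resolve_right hs, hout.conn⟩
      · exact Or.inl h

theorem Conn.exists_connectingWalk {X Y Z : Set V} {x y : V} (hx : x ∈ X) (hy : y ∈ Y)
    (h : D.Conn X Z y x) : ∃ n f, D.ConnectingWalk X Y Z f n := by
  obtain ⟨f, n, h, rfl⟩ := h
  obtain ⟨m, hm, he, hX⟩ := h.tag
  set l := Nat.findGreatest (fun i => f i ∈ X) m with hl
  have hlm : l ≤ m := Nat.findGreatest_le m
  have hlX : f l ∈ X := Nat.findGreatest_spec (P := fun i => f i ∈ X) (Nat.zero_le m) hx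
  refine ⟨n - l, fun i => f (l + i), ⟨⟨fun i hi => h.adj (l + i) (by omega),
    fun i hi => h.collider (l + i) (by omega), fun i hi => h.nonCollider (l + i) (by omega)⟩,
    hlX, ?_, fun i hi => ?_, m - l, by omega, ?_⟩⟩
  · rw [show l + (n - l) = n by omega, h.end_eq]
    exact hy
  · rcases Nat.lt_or_ge m (l + (i + 1)) with hlt | hge
    · exact hX _ hlt (by omega)
    · exact Nat.findGreatest_is_greatest (P := fun i => f i ∈ X) (by omega) hge
  · rw [show l + (m - l + 1) = m + 1 by omega, show l + (m - l) = m by omega]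
    exact fun he' => D.acyclic _ (.tail (.single he) he')

theorem ActiveWalk.transGen_or_exists {Z : Set V} {f : ℕ → V} {n : ℕ} (h : D.ActiveWalk Z f n)
    {i : ℕ} (he : D.Edge (f i) (f (i + 1))) {j : ℕ} (hij : i + 1 ≤ j) (hj : j ≤ n) :
    Relation.TransGen D.Edge (f i) (f j) ∧ D.Edge (f (j - 1)) (f j) ∨
      ∃ z ∈ Z, Relation.ReflTransGen D.Edge (f i) z := by
  induction j, hij using Nat.le_induction with
  | base => exact Or.inl ⟨.single he, he⟩
  | succ j hij ih =>
    rcases ih (by omega) with ⟨h1, h2⟩ | h1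
    · rcases h.adj j (by omega) with he' | he'
      · exact Or.inl ⟨h1.tail he', he'⟩
      · obtain ⟨k, rfl⟩ : ∃ k, j = k + 1 := ⟨j - 1, by omega⟩
        obtain ⟨z, hz, hz'⟩ := h.collider k (by omega) h2 he'
        exact Or.inr ⟨z, hz, h1.to_reflTransGen.trans hz'⟩
    · exact Or.inr h1

/-- a node that a d-connecting walk enters and later revisits is an ancestor of `Z` -/
theorem ActiveWalk.exists_of_revisit {Z : Set V} {f : ℕ → V} {n : ℕ} (h : D.ActiveWalk Z f n)
    {i j : ℕ} (hij : i + 1 < j) (hj : j ≤ n) (hf : f (i + 1) = f j)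
    (he : D.Edge (f i) (f (i + 1))) :
    ∃ z ∈ Z, Relation.ReflTransGen D.Edge (f (i + 1)) z := by
  rcases h.adj (i + 1) (by omega) with he' | he'
  · rcases h.transGen_or_exists he' hij hj with ⟨h1, -⟩ | h1
    · exact absurd (hf ▸ h1) (D.acyclic _)
    · exact h1
  · exact h.collider i (by omega) he he'

theorem ActiveWalk.shortcut {Z : Set V} {f : ℕ → V} {n : ℕ} (h : D.ActiveWalk Z f n)
    {i j : ℕ} (hij : i < j) (hj : j ≤ n) (hf : f i = f j) :
    D.ActiveWalk Z (fun k => if k ≤ i then f k else f (k + (j - i))) (n - (j - i)) := by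
  set q : ℕ → V := fun k => if k ≤ i then f k else f (k + (j - i)) with hq
  have hle : ∀ k ≤ i, q k = f k := fun k hk => if_pos hk
  have hge : ∀ k, i ≤ k → q k = f (k + (j - i)) := fun k hk => by
    rcases hk.eq_or_lt with rfl | hk
    · rw [hle i le_rfl, hf, show i + (j - i) = j by omega]
    · exact if_neg (by omega)
  refine ⟨fun k hk => ?_, fun k hk h1 h2 => ?_, fun k hk hz => ?_⟩
  · rcases Nat.lt_or_ge k i with hki | hki
    · rw [hle k hki.le, hle (k + 1) hki]
      exact h.adj k (by omega)
    · rw [hge k hki, hge (k + 1) (by omega), add_right_comm]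
      exact h.adj (k + (j - i)) (by omega)
  · rcases lt_trichotomy (k + 1) i with hki | rfl | hki
    · rw [hle k (by omega), hle (k + 1) (by omega)] at h1
      rw [hle (k + 1) (by omega), hle (k + 2) (by omega)] at h2
      rw [hle (k + 1) (by omega)]
      exact h.collider k (by omega) h1 h2
    · rw [hle k (by omega), hle (k + 1) le_rfl] at h1
      rw [hle (k + 1) le_rfl]
      exact h.exists_of_revisit hij hj hf h1
    · rw [hge k (by omega), hge (k + 1) (by omega), add_right_comm] at h1
      rw [hge (k + 1) (by omega), hge (k + 2) (by omega), add_right_comm k 1,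
        add_right_comm k 2] at h2
      rw [hge (k + 1) (by omega), add_right_comm]
      exact h.collider (k + (j - i)) (by omega) h1 h2
  · rcases lt_trichotomy (k + 1) i with hki | rfl | hki
    · rw [hle (k + 1) (by omega)] at hz ⊢
      rw [hle k (by omega), hle (k + 2) (by omega)]
      exact h.nonCollider k (by omega) hz
    · rw [hle (k + 1) le_rfl] at hz ⊢
      rw [hle k (by omega), hge (k + 2) (by omega)]
      obtain ⟨l, rfl⟩ : ∃ l, j = l + 1 := ⟨j - 1, by omega⟩
      refine ⟨(h.nonCollider k (by omega) hz).1, ?_⟩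
      rw [hf, show k + 2 + (l + 1 - (k + 1)) = l + 2 by omega]
      exact (h.nonCollider l (by omega) (hf ▸ hz)).2
    · rw [hge (k + 1) (by omega), add_right_comm] at hz ⊢
      rw [hge k (by omega), hge (k + 2) (by omega), add_right_comm k 2]
      exact h.nonCollider (k + (j - i)) (by omega) hz

theorem reflTransGen_edgeBetween_of_forall {X : Set V} {f : ℕ → V} {n : ℕ}
    (he : ∀ i < n, D.Edge (f i) (f (i + 1))) (hX : ∀ i < n, f (i + 1) ∉ X) {i j : ℕ}
    (hij : i ≤ j) (hj : j ≤ n) : Relation.ReflTransGen (D.EdgeBetween X ∅) (f i) (f j) := by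
  induction j, hij using Nat.le_induction with
  | base => exact .refl
  | succ j _ ih => exact (ih (by omega)).tail ⟨he j (by omega), id, hX j (by omega)⟩

theorem ConnectingWalk.shortcut {X Y Z : Set V} (hF : Z ∩ D.Forb X Y = ∅) {f : ℕ → V} {n : ℕ}
    (h : D.ConnectingWalk X Y Z f n) {i j : ℕ} (hij : i < j) (hj : j ≤ n) (hf : f i = f j) :
    D.ConnectingWalk X Y Z (fun k => if k ≤ i then f k else f (k + (j - i))) (n - (j - i)) := by
  have hact := h.toActiveWalk.shortcut hij hj hf
  set q : ℕ → V := fun k => if k ≤ i then f k else f (k + (j - i)) with hq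
  have hle : ∀ k ≤ i, q k = f k := fun k hk => if_pos hk
  have hend : q (n - (j - i)) = f n := by
    rcases hj.eq_or_lt with rfl | hj
    · rw [hle _ (by omega), show j - (j - i) = i by omega, hf]
    · rw [hq]
      simp only [show ¬ n - (j - i) ≤ i by omega, if_false,
        show n - (j - i) + (j - i) = n by omega]
  have hpr : ∀ k < n - (j - i), q (k + 1) ∉ X := fun k hk => by
    rw [hq]
    beta_reduce
    split_ifs
    · exact h.proper k (by omega)
    · rw [add_right_comm]
      exact h.proper (k + (j - i)) (by omega)
  refine ⟨hact, by rw [hle 0 (Nat.zero_le i)]; exact h.start_mem, hend ▸ h.end_mem, hpr, ?_⟩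
  by_contra hcon
  push Not at hcon
  obtain ⟨k, rfl⟩ : ∃ k, i = k + 1 := by
    refine ⟨i - 1, ?_⟩
    by_contra hi
    obtain ⟨rfl, l, rfl⟩ : i = 0 ∧ ∃ l, j = l + 1 := ⟨by omega, j - 1, by omega⟩
    exact h.proper l (by omega) (hf ▸ h.start_mem)
  have he := hcon k (by omega)
  rw [hle k (by omega), hle (k + 1) le_rfl] at he
  obtain ⟨z, hz, hvz⟩ := h.toActiveWalk.exists_of_revisit hij hj hf he
  have h1 := reflTransGen_edgeBetween_of_forall hcon hpr (Nat.zero_le (k + 1)) (by omega)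
  have h2 := reflTransGen_edgeBetween_of_forall hcon hpr
    (show k + 1 ≤ n - (j - (k + 1)) by omega) le_rfl
  rw [hle 0 (Nat.zero_le _), hle (k + 1) le_rfl] at h1
  rw [hle (k + 1) le_rfl, hend] at h2
  exact Set.notMem_empty z
    (hF ▸ ⟨hz, mem_forb h.start_mem h.end_mem (h.proper k (by omega)) h1 h2 hvz⟩)

theorem SatisfiesAC.not_linked {X Y Z : Set V} {x y : V} (hXZ : Disjoint X Z) (hx : x ∈ X)
    (hy : y ∈ Y) (hyW : y ∉ X ∪ Z) (h : D.SatisfiesAC X Y Z) : ¬ D.Linked X Z y x := by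
  intro hl
  have hconn : D.Conn X Z y x := by
    rcases hl.connInto_or hXZ hyW (Or.inl hx) with h | h
    · exact h.conn
    · exact h.2
  have hex := hconn.exists_connectingWalk hx hy
  obtain ⟨f, hf⟩ := Nat.find_spec hex
  have hne : ∀ i j, i < j → j ≤ Nat.find hex → f i ≠ f j := fun i j hij hj hfij =>
    Nat.find_min hex (m := Nat.find hex - (j - i)) (by omega) ⟨_, hf.shortcut h.1 hij hj hfij⟩
  have hinj : Set.InjOn f (Set.Iic (Nat.find hex)) := by
    intro i hi j hj hij
    rcases lt_trichotomy i j with h | h | h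
    · exact absurd hij (hne i j h hj)
    · exact h
    · exact absurd hij.symm (hne j i h hi)
  obtain ⟨p, hp, hb⟩ := hf.exists_path hinj
  exact hb (h.2 p hp)

end DAG

/-- `Z` satisfies the adjustment criterion relative to `(X, Y)` in the
DAG `D` if and only if in every linear Gaussian SEM compatible with `D`, for every
`y ∈ Y` and every assignment `x` to `X`, `E[y | do(X = x)]` equals `E[y | X = x]` when
`Z = ∅` and equals `∫ E[y | X = x, Z = z] f_Z(z) dz` otherwise. -/
theorem adjustment_criterion_iff_gaussian_adjustment
    {V : Type} [Fintype V] [DecidableEq V]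
    (D : DAG V) (X Y Z : Set V)
    (hXY : Disjoint X Y) (hXZ : Disjoint X Z) (hYZ : Disjoint Y Z)
    (hX : X.Nonempty) (hY : Y.Nonempty) :
    D.SatisfiesAC X Y Z ↔
      ∀ (S : GaussianSEM V D), ∀ y ∈ Y, ∀ x : V → ℝ,
        (Z = ∅ → S.doMean X x y = S.condExp y X x) ∧
        (Z ≠ ∅ → S.doMean X x y = S.adjIntegral X Z x y) := by
  have hyW : ∀ y ∈ Y, y ∉ X ∪ Z := fun y hy => by
    simp [hXY.notMem_of_mem_right hy, hYZ.notMem_of_mem_left hy]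
  constructor
  · intro h S y hy
    exact S.adjusts_of_not_linked hXZ (hyW y hy) (fun x hx => h.not_linked hXZ hx hy (hyW y hy))
      (DAG.not_mediated hXZ hy (hyW y hy) h.1)
  · intro h
    have hl : ∀ y ∈ Y, ∀ x ∈ X, ¬ D.Linked X Z y x := by
      intro y hy x hx hl
      obtain ⟨S, v, hS⟩ := GaussianSEM.exists_not_adjusts_of_linked hXZ (hyW y hy) hx hl
      exact hS (h S y hy v)
    refine DAG.satisfiesAC_of_not_linked hXZ hYZ hl fun y hy hm => ?_
    obtain ⟨S, v, hS⟩ := GaussianSEM.exists_not_adjusts_of_mediated hXZ (hyW y hy) (hl y hy) hm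
    exact hS (h S y hy v)
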